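/- arXiv:2009.00899 — 10 statements merged into one kernel-verified Lean document; each statement's English description precedes it below -/
import Mathlib

section
/- Let T>0 and let K:[0,T)→ℝ be a càdlàg function. For every α∈ℝ define the Riemann–Liouville type operator by I_t^α K := (α/T^α)∫_0^t (T−u)^{α−1} K_u du + ((T−t)/T)^α K_t for t∈[0,T). Then for all α,β∈ℝ and all t∈[0,T) one has I_t^α(I^β K) = I_t^{α+β} K; in particular I_t^{−α}(I^α K) = K_t for all α∈ℝ and t∈[0,T). -/
open MeasureTheory Filter Set

/-- A function `K : ℝ → ℝ` is càdlàg on `[0,T)`: it is right-continuous at every point of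
`[0,T)` and has left limits at every point of `(0,T)`. -/
def CadlagOn (K : ℝ → ℝ) (T : ℝ) : Prop :=
  (∀ t ∈ Set.Ico (0:ℝ) T, Filter.Tendsto K (nhdsWithin t (Set.Ici t)) (nhds (K t))) ∧
  (∀ t ∈ Set.Ioo (0:ℝ) T, ∃ l : ℝ, Filter.Tendsto K (nhdsWithin t (Set.Iio t)) (nhds l))

/-- The Riemann–Liouville type operator
`I_t^α K := (α/T^α) ∫_0^t (T−u)^{α−1} K_u du + ((T−t)/T)^α K_t` for `α ∈ ℝ`. -/
noncomputable def rl (T α : ℝ) (K : ℝ → ℝ) (t : ℝ) : ℝ :=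
  (α / T ^ α) * (∫ u in (0:ℝ)..t, (T - u) ^ (α - 1) * K u) + ((T - t) / T) ^ α * K t

lemma cad_meas (T : ℝ) (K : ℝ → ℝ) (hK : CadlagOn K T) :
    AEStronglyMeasurable K (volume.restrict (Set.Ico 0 T)) := by
  refine aestronglyMeasurable_of_tendsto_ae atTop
    (f := fun (n : ℕ) x => K (((⌊((n:ℝ)+1) * x⌋ : ℝ) + 1) / ((n:ℝ)+1))) ?_ ?_
  · intro n
    have h1 : Measurable fun x : ℝ => ⌊((n:ℝ)+1) * x⌋ :=
      Int.measurable_floor.comp (measurable_const.mul measurable_id)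
    have h2 : Measurable fun z : ℤ => K (((z : ℝ) + 1) / ((n:ℝ)+1)) := measurable_from_top
    exact (h2.comp h1).aestronglyMeasurable
  · refine (ae_restrict_iff' measurableSet_Ico).2 (Eventually.of_forall fun x hx => ?_)
    refine (hK.1 x hx).comp ?_
    have hl : ∀ n : ℕ, x ≤ ((⌊((n:ℝ)+1) * x⌋ : ℝ) + 1) / ((n:ℝ)+1) := fun n => by
      rw [le_div_iff₀ (by positivity)]
      linarith [Int.lt_floor_add_one (((n:ℝ)+1) * x)]
    have hu : ∀ n : ℕ, ((⌊((n:ℝ)+1) * x⌋ : ℝ) + 1) / ((n:ℝ)+1) ≤ x + 1 / ((n:ℝ)+1) := fun n => by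
      have : (0:ℝ) < (n:ℝ)+1 := by positivity
      rw [div_le_iff₀ this, add_mul x, one_div_mul_cancel this.ne']
      linarith [Int.floor_le (((n:ℝ)+1) * x)]
    refine tendsto_nhdsWithin_iff.2 ⟨?_, Eventually.of_forall hl⟩
    refine tendsto_of_tendsto_of_tendsto_of_le_of_le tendsto_const_nhds ?_ hl hu
    simpa using (tendsto_const_nhds (x := x)).add (tendsto_one_div_add_atTop_nhds_zero_nat (𝕜 := ℝ))

lemma cad_int (T : ℝ) (K : ℝ → ℝ) (hK : CadlagOn K T) (t : ℝ) (ht : t ∈ Set.Ico 0 T) :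
    IntegrableOn K (Set.Icc 0 t) := by
  have hm : AEStronglyMeasurable K (volume.restrict (Set.Icc 0 t)) :=
    (cad_meas T K hK).mono_measure
      (Measure.restrict_mono (Icc_subset_Ico_right ht.2) le_rfl)
  have key : IntegrableOn K (Set.Icc 0 t) (volume.restrict (Set.Icc 0 t)) := by
    refine LocallyIntegrableOn.integrableOn_isCompact (fun x hx => ?_) isCompact_Icc
    have hxT : x < T := hx.2.trans_lt ht.2
    have hmf : ∀ l : Filter ℝ, StronglyMeasurableAtFilter K l (volume.restrict (Set.Icc 0 t)) :=
      fun l => ⟨univ, univ_mem, by simpa using hm⟩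
    have hR : IntegrableAtFilter K (nhdsWithin x (Ici x)) (volume.restrict (Set.Icc 0 t)) :=
      (hK.1 x ⟨hx.1, hxT⟩).integrableAtFilter (hmf _)
        (Measure.finiteAt_nhdsWithin _ _ _)
    rcases hx.1.eq_or_lt with h0 | h0
    · subst h0
      exact hR.filter_mono (nhdsWithin_mono _ fun y hy => hy.1)
    · obtain ⟨l, hl⟩ := hK.2 x ⟨h0, hxT⟩
      have hL : IntegrableAtFilter K (nhdsWithin x (Iio x)) (volume.restrict (Set.Icc 0 t)) :=
        hl.integrableAtFilter (hmf _) (Measure.finiteAt_nhdsWithin _ _ _)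
      have := IntegrableAtFilter.sup_iff.2 ⟨hL, hR⟩
      refine this.filter_mono ?_
      rw [← nhdsWithin_union, Iio_union_Ici]
      exact nhdsWithin_mono _ (subset_univ _)
  simpa [IntegrableOn, Measure.restrict_restrict] using key

lemma cad_parts (T : ℝ) (K : ℝ → ℝ) (hK : CadlagOn K T) (t : ℝ)
    (ht : t ∈ Set.Ico 0 T) (α β : ℝ) :
    IntervalIntegrable K volume 0 t ∧
    (∀ p : ℝ, ContinuousOn (fun u => (T - u) ^ p) (uIcc 0 t)) ∧
    ContinuousOn (fun u => ∫ s in (0:ℝ)..u, (T - s) ^ (β - 1) * K s) (uIcc 0 t) ∧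
    -(α * ∫ u in (0:ℝ)..t, (T - u) ^ (α - 1) * ∫ s in (0:ℝ)..u, (T - s) ^ (β - 1) * K s)
      + (∫ u in (0:ℝ)..t, (T - u) ^ (α + β - 1) * K u)
      = (T - t) ^ α * ∫ s in (0:ℝ)..t, (T - s) ^ (β - 1) * K s := by
  have hi : IntervalIntegrable K volume 0 t :=
    (intervalIntegrable_iff_integrableOn_Icc_of_le ht.1).2 (cad_int T K hK t ht)
  have hpos : ∀ u ∈ uIcc 0 t, 0 < T - u := fun u hu => by
    rw [uIcc_of_le ht.1] at hu
    linarith [hu.2, ht.2]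
  have hc : ∀ p : ℝ, ContinuousOn (fun u => (T - u) ^ p) (uIcc 0 t) := fun p =>
    ContinuousOn.rpow_const (by fun_prop) fun u hu => Or.inl (hpos u hu).ne'
  have hg : ∀ p : ℝ, IntervalIntegrable (fun u => (T - u) ^ p * K u) volume 0 t :=
    fun p => hi.continuousOn_mul (hc p)
  have hG : ContinuousOn (fun u => ∫ s in (0:ℝ)..u, (T - s) ^ (β - 1) * K s) (uIcc 0 t) :=
    intervalIntegral.continuousOn_primitive_interval' (hg _) left_mem_uIcc
  refine ⟨hi, hc, hG, ?_⟩
  have hA : IntervalIntegrable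
      (fun u => (T - u) ^ (α - 1) * ∫ s in (0:ℝ)..u, (T - s) ^ (β - 1) * K s) volume 0 t :=
    ((hc _).mul hG).intervalIntegrable
  have h := intervalIntegral.integral_eq_sub_of_hasDeriv_right
    (f := fun u => (T - u) ^ α * ∫ s in (0:ℝ)..u, (T - s) ^ (β - 1) * K s)
    (f' := fun u => -(α * ((T - u) ^ (α - 1) * ∫ s in (0:ℝ)..u, (T - s) ^ (β - 1) * K s))
      + (T - u) ^ (α + β - 1) * K u) (a := 0) (b := t) ((hc _).mul hG) ?_
      ((hA.const_mul α).neg.add (hg _))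
  · have hn : IntervalIntegrable (fun u => -(α * ((T - u) ^ (α - 1) *
        ∫ s in (0:ℝ)..u, (T - s) ^ (β - 1) * K s))) volume 0 t := (hA.const_mul α).neg
    rw [intervalIntegral.integral_add hn (hg _), intervalIntegral.integral_neg,
      intervalIntegral.integral_const_mul] at h
    simpa using h
  · intro x hx
    rw [min_eq_left ht.1, max_eq_right ht.1] at hx
    have hxt : x ∈ uIcc 0 t := by rw [uIcc_of_le ht.1]; exact ⟨hx.1.le, hx.2.le⟩
    have hp := hpos x hxt
    have hsub : uIcc 0 x ⊆ uIcc 0 t := uIcc_subset_uIcc left_mem_uIcc hxt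
    have h1 : HasDerivAt (fun u => (T - u) ^ α) (-1 * α * (T - x) ^ (α - 1)) x :=
      ((hasDerivAt_id x).const_sub T).rpow_const (Or.inl hp.ne')
    have hcx : ContinuousWithinAt (fun s => (T - s) ^ (β - 1) * K s) (Ioi x) x := by
      refine ContinuousWithinAt.mul ?_ ?_
      · exact (ContinuousAt.rpow_const (by fun_prop) (Or.inl hp.ne')).continuousWithinAt
      · exact (hK.1 x ⟨hx.1.le, hx.2.trans ht.2⟩).mono_left (nhdsWithin_mono _ Ioi_subset_Ici_self)
    have hms : StronglyMeasurableAtFilter (fun s => (T - s) ^ (β - 1) * K s)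
        (nhdsWithin x (Ioi x)) volume := by
      refine ⟨Ioc 0 t, ?_, (hg (β-1)).1.1⟩
      exact mem_nhdsWithin_of_mem_nhds (Ioc_mem_nhds hx.1 hx.2)
    have h2 : HasDerivWithinAt (fun u => ∫ s in (0:ℝ)..u, (T - s) ^ (β - 1) * K s)
        ((T - x) ^ (β - 1) * K x) (Ioi x) x :=
      (intervalIntegral.integral_hasDerivWithinAt_right ((hg _).mono_set hsub) hms hcx :
        HasDerivWithinAt _ _ (Ici x) x).mono Ioi_subset_Ici_self
    refine (h1.hasDerivWithinAt.mul h2).congr_deriv ?_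
    rw [show α + β - 1 = α + (β - 1) by ring, Real.rpow_add hp]
    ring

lemma rl_add (T : ℝ) (hT : 0 < T) (K : ℝ → ℝ) (hK : CadlagOn K T) (α β : ℝ) (t : ℝ)
    (ht : t ∈ Set.Ico (0:ℝ) T) : rl T α (rl T β K) t = rl T (α + β) K t := by
  obtain ⟨hi, hc, hG, h⟩ := cad_parts T K hK t ht α β
  have e : ∫ u in (0:ℝ)..t, (T - u) ^ (α - 1) * rl T β K u =
      β / T ^ β * (∫ u in (0:ℝ)..t, (T - u) ^ (α - 1) * ∫ s in (0:ℝ)..u, (T - s) ^ (β - 1) * K s)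
      + 1 / T ^ β * ∫ u in (0:ℝ)..t, (T - u) ^ (α + β - 1) * K u := by
    rw [← intervalIntegral.integral_const_mul, ← intervalIntegral.integral_const_mul,
      ← intervalIntegral.integral_add]
    · refine intervalIntegral.integral_congr fun u hu => ?_
      rw [uIcc_of_le ht.1] at hu
      have hp : 0 < T - u := by linarith [hu.2, ht.2]
      simp only [rl]
      rw [show α + β - 1 = α - 1 + β by ring, Real.rpow_add hp, Real.div_rpow hp.le hT.le]
      ring
    · exact (((hc _).mul hG).intervalIntegrable).const_mul _
    · exact (hi.continuousOn_mul (hc _)).const_mul _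
  have hp : 0 < T - t := by linarith [ht.2]
  rw [rl, e, rl, rl, Real.rpow_add hT, Real.rpow_add (by positivity), Real.div_rpow hp.le hT.le]
  have a0 := (Real.rpow_pos_of_pos hT α).ne'
  have b0 := (Real.rpow_pos_of_pos hT β).ne'
  generalize (∫ u in (0:ℝ)..t, (T - u) ^ (α - 1) * ∫ s in (0:ℝ)..u, (T - s) ^ (β - 1) * K s) = A at *
  generalize (∫ u in (0:ℝ)..t, (T - u) ^ (α + β - 1) * K u) = B at *
  generalize (∫ s in (0:ℝ)..t, (T - s) ^ (β - 1) * K s) = C at *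
  field_simp
  linear_combination (-β) * h

/-- Group property of the Riemann–Liouville type operators: `I_t^α (I^β K) = I_t^{α+β} K`
for all real `α, β` and `t ∈ [0,T)`; in particular `I_t^{−α}(I^α K) = K_t`. -/
theorem rl_group (T : ℝ) (hT : 0 < T) (K : ℝ → ℝ) (hK : CadlagOn K T) :
    (∀ α β : ℝ, ∀ t ∈ Set.Ico (0:ℝ) T, rl T α (rl T β K) t = rl T (α + β) K t) ∧
    (∀ α : ℝ, ∀ t ∈ Set.Ico (0:ℝ) T, rl T (-α) (rl T α K) t = K t) := by
  refine ⟨fun α β t ht => rl_add T hT K hK α β t ht, fun α t ht => ?_⟩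
  rw [rl_add T hT K hK _ _ t ht]
  simp [rl]
end

section
/- Let T>0 and let K:[0,T)→ℝ be a càdlàg function. Then for every t∈[0,T): (1) lim_{α↓0} I_t^α K = K_t; (2) lim_{α→∞} I_t^α K = K_0; (3) for every α∈ℝ, the jump of I^α K at t satisfies Δ(I^α K)_t = ((T−t)/T)^α ΔK_t, where ΔF_t := F_t − lim_{s↑t,s<t} F_s for t∈(0,T) and ΔF_0 := 0. -/
open MeasureTheory Filter Set

lemma rl_meas (T : ℝ) (K : ℝ → ℝ) (hK : CadlagOn K T) :
    Measurable ((Set.Ico (0:ℝ) T).indicator K) := by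
  have h1 : ∀ n : ℕ, Measurable ((Set.Ico (0:ℝ) T).indicator
      (fun u => K (((⌊((n:ℝ) + 1) * u⌋ : ℝ) + 1) / ((n:ℝ) + 1)))) := by
    intro n
    refine Measurable.indicator ?_ measurableSet_Ico
    have h2 : Measurable (fun z : ℤ => K (((z : ℝ) + 1) / ((n:ℝ) + 1))) := measurable_from_top
    exact h2.comp (Int.measurable_floor.comp (measurable_const.mul measurable_id))
  refine measurable_of_tendsto_metrizable h1 ?_
  rw [tendsto_pi_nhds]
  intro u
  by_cases hu : u ∈ Set.Ico (0:ℝ) T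
  · simp only [Set.indicator_of_mem hu]
    refine (hK.1 u hu).comp ?_
    refine tendsto_nhdsWithin_iff.2 ⟨?_, ?_⟩
    · have h3 : Tendsto (fun n : ℕ => u + 1 / ((n:ℝ) + 1)) atTop (nhds u) := by
        simpa using tendsto_const_nhds.add (tendsto_one_div_add_atTop_nhds_zero_nat (𝕜 := ℝ))
      refine tendsto_of_tendsto_of_tendsto_of_le_of_le tendsto_const_nhds h3 ?_ ?_
      · intro n
        have hn : (0:ℝ) < (n:ℝ) + 1 := by positivity
        simp only
        rw [le_div_iff₀ hn]
        nlinarith [Int.lt_floor_add_one (((n:ℝ) + 1) * u)]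
      · intro n
        have hn : (0:ℝ) < (n:ℝ) + 1 := by positivity
        simp only
        rw [div_le_iff₀ hn, add_mul u, one_div, inv_mul_cancel₀ hn.ne']
        nlinarith [Int.floor_le (((n:ℝ) + 1) * u)]
    · refine Eventually.of_forall fun n => ?_
      have hn : (0:ℝ) < (n:ℝ) + 1 := by positivity
      simp only [Set.mem_Ici]
      rw [le_div_iff₀ hn]
      nlinarith [Int.lt_floor_add_one (((n:ℝ) + 1) * u)]
  · simp only [Set.indicator_of_notMem hu]
    exact tendsto_const_nhds

lemma rl_bdd (T : ℝ) (K : ℝ → ℝ) (hK : CadlagOn K T) (t : ℝ) (ht : t < T) :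
    ∃ C : ℝ, 0 ≤ C ∧ ∀ u ∈ Set.Icc (0:ℝ) t, |K u| ≤ C := by
  have key : ∃ C : ℝ, ∀ u ∈ Set.Icc (0:ℝ) t, |K u| ≤ C := by
    refine isCompact_Icc.induction_on (p := fun s => ∃ C : ℝ, ∀ u ∈ s, |K u| ≤ C)
      ⟨0, by simp⟩ ?_ ?_ ?_
    · rintro s s' hs ⟨C, hC⟩
      exact ⟨C, fun u hu => hC u (hs hu)⟩
    · rintro s s' ⟨C, hC⟩ ⟨D, hD⟩
      refine ⟨max C D, fun u hu => ?_⟩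
      rcases hu with hu | hu
      · exact (hC u hu).trans (le_max_left _ _)
      · exact (hD u hu).trans (le_max_right _ _)
    · intro x hx
      have bd : ∀ (l : ℝ) (F : Filter ℝ), Tendsto K F (nhds l) → ∀ᶠ u in F, |K u| ≤ |l| + 1 := by
        intro l F h
        filter_upwards [h.abs.eventually (gt_mem_nhds (lt_add_one |l|))] with u hu using hu.le
      have hr := bd _ _ (hK.1 x ⟨hx.1, hx.2.trans_lt ht⟩)
      have hl : ∃ D : ℝ, ∀ᶠ u in nhdsWithin x (Set.Iio x), u ∈ Set.Icc 0 t → |K u| ≤ D := by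
        rcases hx.1.eq_or_lt with h0 | h0
        · refine ⟨0, ?_⟩
          filter_upwards [self_mem_nhdsWithin] with u hu hu2
          exact absurd hu2.1 (not_le.2 (by rw [h0]; exact hu))
        · obtain ⟨l, hl⟩ := hK.2 x ⟨h0, hx.2.trans_lt ht⟩
          exact ⟨|l| + 1, (bd _ _ hl).mono fun u hu _ => hu⟩
      obtain ⟨D, hD⟩ := hl
      have hall : ∀ᶠ u in nhds x, u ∈ Set.Icc 0 t → |K u| ≤ max D (|K x| + 1) := by
        rw [← nhdsLT_sup_nhdsGE, eventually_sup]
        exact ⟨hD.mono fun u hu h => (hu h).trans (le_max_left _ _),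
          hr.mono fun u hu _ => hu.trans (le_max_right _ _)⟩
      exact ⟨{u | |K u| ≤ max D (|K x| + 1)}, mem_nhdsWithin_iff_eventually.2 hall, _, fun u hu => hu⟩
  obtain ⟨C, hC⟩ := key
  exact ⟨|C|, abs_nonneg _, fun u hu => (hC u hu).trans (le_abs_self _)⟩

lemma rl_kcont (T α a b : ℝ) (hb : b < T) :
    ContinuousOn (fun u : ℝ => (T - u) ^ (α - 1)) (Set.Icc a b) := by
  refine ContinuousOn.rpow_const (by fun_prop) ?_
  intro u hu
  left
  have := hu.2
  linarith

lemma rl_int (T : ℝ) (K : ℝ → ℝ) (hK : CadlagOn K T) (α t : ℝ) (ht : t < T) :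
    IntegrableOn (fun u : ℝ => (T - u) ^ (α - 1) * K u) (Set.Icc 0 t) := by
  obtain ⟨C, hC0, hC⟩ := rl_bdd T K hK t ht
  have hKi : IntegrableOn K (Set.Icc 0 t) := by
    have h1 : IntegrableOn ((Set.Ico (0:ℝ) T).indicator K) (Set.Icc 0 t) := by
      refine Measure.integrableOn_of_bounded (M := C) (by simp)
        (rl_meas T K hK).aestronglyMeasurable ?_
      filter_upwards [ae_restrict_mem measurableSet_Icc] with u hu
      rw [Set.indicator_of_mem (show u ∈ Set.Ico 0 T from ⟨hu.1, hu.2.trans_lt ht⟩)]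
      exact hC u hu
    refine h1.congr_fun ?_ measurableSet_Icc
    intro u hu
    exact Set.indicator_of_mem (show u ∈ Set.Ico 0 T from ⟨hu.1, hu.2.trans_lt ht⟩) _
  exact hKi.continuousOn_mul (rl_kcont T α 0 t ht) isCompact_Icc

lemma rl_ii (T : ℝ) (K : ℝ → ℝ) (hK : CadlagOn K T) (α a b : ℝ) (ha : 0 ≤ a) (hab : a ≤ b)
    (hb : b < T) :
    IntervalIntegrable (fun u : ℝ => (T - u) ^ (α - 1) * K u) volume a b := by
  rw [intervalIntegrable_iff_integrableOn_Icc_of_le hab]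
  exact (rl_int T K hK α b hb).mono_set (Set.Icc_subset_Icc_left ha)

lemma rl_kii (T α a b : ℝ) (hab : a ≤ b) (hb : b < T) :
    IntervalIntegrable (fun u : ℝ => (T - u) ^ (α - 1)) volume a b := by
  refine ContinuousOn.intervalIntegrable ?_
  rw [Set.uIcc_of_le hab]
  exact rl_kcont T α a b hb

lemma rl_kval (T α a b : ℝ) (hT : 0 < T) (hα : 0 < α) (hab : a ≤ b) (hb : b < T) :
    (α / T ^ α) * ∫ u in a..b, (T - u) ^ (α - 1) = ((T - a) / T) ^ α - ((T - b) / T) ^ α := by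
  have h : ∫ u in a..b, (T - u) ^ (α - 1) = ((T - a) ^ α - (T - b) ^ α) / α := by
    rw [intervalIntegral.integral_comp_sub_left (fun x : ℝ => x ^ (α - 1)) T,
      integral_rpow (Or.inl (by linarith))]
    simp
  rw [h, Real.div_rpow (by linarith) hT.le, Real.div_rpow (by linarith) hT.le]
  have : T ^ α ≠ 0 := (Real.rpow_pos_of_pos hT α).ne'
  field_simp

lemma rl_bound (T α a b : ℝ) (hT : 0 < T) (hα : 0 < α) (hab : a ≤ b) (hb : b < T)
    (g : ℝ → ℝ) (C : ℝ) (hg : ∀ u ∈ Set.Icc a b, |g u| ≤ C) :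
    |(α / T ^ α) * ∫ u in a..b, (T - u) ^ (α - 1) * g u|
      ≤ C * (((T - a) / T) ^ α - ((T - b) / T) ^ α) := by
  have hpos : 0 < α / T ^ α := div_pos hα (Real.rpow_pos_of_pos hT α)
  have h1 : ‖∫ u in a..b, (T - u) ^ (α - 1) * g u‖ ≤ ∫ u in a..b, (T - u) ^ (α - 1) * C := by
    refine intervalIntegral.norm_integral_le_of_norm_le hab ?_ ((rl_kii T α a b hab hb).mul_const C)
    refine Eventually.of_forall fun u hu => ?_
    have h0 : 0 ≤ (T - u) ^ (α - 1) := Real.rpow_nonneg (by have := hu.2; linarith) _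
    rw [norm_mul, Real.norm_of_nonneg h0]
    exact mul_le_mul_of_nonneg_left (hg u (Set.Ioc_subset_Icc_self hu)) h0
  rw [abs_mul, abs_of_pos hpos, ← rl_kval T α a b hT hα hab hb]
  rw [intervalIntegral.integral_mul_const] at h1
  calc _ ≤ α / T ^ α * ((∫ u in a..b, (T - u) ^ (α - 1)) * C) :=
        mul_le_mul_of_nonneg_left h1 hpos.le
    _ = _ := by ring

/-- Basic limit behaviour of the Riemann–Liouville type operators:
(1) `I_t^α K → K_t` as `α ↓ 0`;
(2) `I_t^α K → K_0` as `α → ∞`;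
(3) the jump at `t ∈ (0,T)` satisfies `Δ(I^α K)_t = ((T−t)/T)^α ΔK_t`, i.e. if `L` is the left
limit of `K` at `t`, then `I^α K` has a left limit `M` at `t` and
`I_t^α K − M = ((T−t)/T)^α (K_t − L)` (the jump at `0` is `0` by convention). -/
theorem rl_limits (T : ℝ) (hT : 0 < T) (K : ℝ → ℝ) (hK : CadlagOn K T) :
    (∀ t ∈ Set.Ico (0:ℝ) T,
      Filter.Tendsto (fun α : ℝ => rl T α K t) (nhdsWithin 0 (Set.Ioi 0)) (nhds (K t))) ∧
    (∀ t ∈ Set.Ico (0:ℝ) T,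
      Filter.Tendsto (fun α : ℝ => rl T α K t) Filter.atTop (nhds (K 0))) ∧
    (∀ α : ℝ, ∀ t ∈ Set.Ioo (0:ℝ) T, ∀ L : ℝ,
      Filter.Tendsto K (nhdsWithin t (Set.Iio t)) (nhds L) →
      ∃ M : ℝ, Filter.Tendsto (fun s => rl T α K s) (nhdsWithin t (Set.Iio t)) (nhds M) ∧
        rl T α K t - M = ((T - t) / T) ^ α * (K t - L)) := by
  refine ⟨?_, ?_, ?_⟩
  · intro t ht
    obtain ⟨C, hC0, hC⟩ := rl_bdd T K hK t ht.2
    have hq : 0 < (T - t) / T := div_pos (by linarith [ht.2]) hT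
    have hc : Tendsto (fun α : ℝ => ((T - t) / T) ^ α) (nhdsWithin 0 (Set.Ioi 0)) (nhds 1) := by
      have := (Real.continuousAt_const_rpow (a := (T - t) / T) (b := 0) hq.ne').tendsto
      rw [Real.rpow_zero] at this
      exact this.mono_left nhdsWithin_le_nhds
    have h1 : Tendsto (fun α : ℝ => (α / T ^ α) * ∫ u in (0:ℝ)..t, (T - u) ^ (α - 1) * K u)
        (nhdsWithin 0 (Set.Ioi 0)) (nhds 0) := by
      have h2 : Tendsto (fun α : ℝ => C * (1 - ((T - t) / T) ^ α))
          (nhdsWithin 0 (Set.Ioi 0)) (nhds 0) := by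
        simpa using ((tendsto_const_nhds (x := (1:ℝ))).sub hc).const_mul C
      refine squeeze_zero_norm' ?_ h2
      filter_upwards [self_mem_nhdsWithin] with α hα
      have := rl_bound T α 0 t hT hα ht.1 ht.2 K C hC
      rwa [sub_zero, div_self hT.ne', Real.one_rpow] at this
    simpa [rl] using h1.add (hc.mul_const (K t))
  · intro t ht
    rcases ht.1.eq_or_lt with h0 | h0
    · subst h0
      simp [rl, hT.ne']
    obtain ⟨C, hC0, hC⟩ := rl_bdd T K hK t ht.2
    have hp : ∀ s : ℝ, 0 < s → s ≤ t →
        Tendsto (fun α : ℝ => ((T - s) / T) ^ α) atTop (nhds 0) := by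
      intro s hs hst
      have hq : 0 < (T - s) / T := div_pos (by linarith [ht.2]) hT
      refine tendsto_rpow_atTop_of_base_lt_one _ (by linarith) ?_
      rw [div_lt_one hT]; linarith
    rw [Metric.tendsto_atTop']
    intro ε hε
    have hr := (hK.1 0 ⟨le_rfl, hT⟩).eventually (Metric.closedBall_mem_nhds (K 0) (half_pos hε))
    obtain ⟨d, hd, hdK⟩ := mem_nhdsGE_iff_exists_Icc_subset.1 hr
    set δ := min d t with hδ
    have hδ0 : 0 < δ := lt_min hd h0
    have hδt : δ ≤ t := min_le_right _ _
    have hlim : Tendsto (fun α : ℝ => (2 * C) * ((T - δ) / T) ^ α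
        + ((T - t) / T) ^ α * |K t - K 0|) atTop (nhds 0) := by
      simpa using ((hp δ hδ0 hδt).const_mul (2 * C)).add ((hp t h0 le_rfl).mul_const |K t - K 0|)
    obtain ⟨N, hN⟩ := eventually_atTop.1 (hlim.eventually (gt_mem_nhds (half_pos hε)))
    refine ⟨max N 0, fun α hα => ?_⟩
    have hα0 : 0 < α := (le_max_right _ _).trans_lt hα
    have hN' := hN α ((le_max_left _ _).trans hα.le)
    have b1 := rl_bound T α 0 δ hT hα0 hδ0.le (hδt.trans_lt ht.2) (fun u => K u - K 0) (ε / 2) (by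
      intro u hu
      exact hdK ⟨hu.1, hu.2.trans (min_le_left _ _)⟩)
    have b2 := rl_bound T α δ t hT hα0 hδt ht.2 (fun u => K u - K 0) (2 * C) (by
      intro u hu
      have e1 := hC u ⟨hδ0.le.trans hu.1, hu.2⟩
      have e2 := hC 0 ⟨le_rfl, h0.le⟩
      have e3 := abs_sub (K u) (K 0)
      linarith)
    rw [sub_zero, div_self hT.ne', Real.one_rpow] at b1
    have hv := rl_kval T α 0 t hT hα0 h0.le ht.2
    rw [sub_zero, div_self hT.ne', Real.one_rpow] at hv
    have ii : ∀ a b : ℝ, 0 ≤ a → a ≤ b → b < T →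
        IntervalIntegrable (fun u : ℝ => (T - u) ^ (α - 1) * (K u - K 0)) volume a b := by
      intro a b ha hab hb
      simp only [mul_sub]
      exact (rl_ii T K hK α a b ha hab hb).sub ((rl_kii T α a b hab hb).mul_const _)
    have hadd := intervalIntegral.integral_add_adjacent_intervals
      (ii 0 δ le_rfl hδ0.le (hδt.trans_lt ht.2)) (ii δ t hδ0.le hδt ht.2)
    have hsub : ∫ u in (0:ℝ)..t, (T - u) ^ (α - 1) * (K u - K 0)
        = (∫ u in (0:ℝ)..t, (T - u) ^ (α - 1) * K u)
          - (∫ u in (0:ℝ)..t, (T - u) ^ (α - 1)) * K 0 := by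
      simp only [mul_sub]
      rw [intervalIntegral.integral_sub (rl_ii T K hK α 0 t le_rfl h0.le ht.2)
        ((rl_kii T α 0 t h0.le ht.2).mul_const _), intervalIntegral.integral_mul_const]
    have hdec : rl T α K t - K 0 =
        (α / T ^ α) * (∫ u in (0:ℝ)..δ, (T - u) ^ (α - 1) * (K u - K 0))
        + (α / T ^ α) * (∫ u in δ..t, (T - u) ^ (α - 1) * (K u - K 0))
        + ((T - t) / T) ^ α * (K t - K 0) := by
      rw [← mul_add, hadd, hsub, rl]
      linear_combination (K 0) * hv
    have hqt : 0 ≤ ((T - t) / T) ^ α :=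
      Real.rpow_nonneg (div_nonneg (by linarith [ht.2]) hT.le) _
    have hqδ : 0 ≤ ((T - δ) / T) ^ α :=
      Real.rpow_nonneg (div_nonneg (by linarith [ht.2]) hT.le) _
    rw [Real.dist_eq, hdec]
    refine (abs_add_three _ _ _).trans_lt ?_
    rw [abs_mul (((T - t) / T) ^ α), abs_of_nonneg hqt]
    have p1 : 0 ≤ ε / 2 * ((T - δ) / T) ^ α := by positivity
    have p2 : 0 ≤ 2 * C * ((T - t) / T) ^ α := by positivity
    linarith
  · intro α t ht L hL
    refine ⟨(α / T ^ α) * (∫ u in (0:ℝ)..t, (T - u) ^ (α - 1) * K u) + ((T - t) / T) ^ α * L,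
      ?_, by rw [rl]; ring⟩
    unfold rl
    have hI := rl_int T K hK α t ht.2
    rw [← Set.uIcc_of_le ht.1.le] at hI
    have hc := intervalIntegral.continuousOn_primitive_interval hI t Set.right_mem_uIcc
    have hle : nhdsWithin t (Set.Iio t) ≤ nhdsWithin t (Set.uIcc 0 t) := by
      rw [Set.uIcc_of_le ht.1.le]
      refine nhdsWithin_le_iff.2 ?_
      exact Filter.mem_of_superset (Ioo_mem_nhdsLT ht.1) Set.Ioo_subset_Icc_self
    have hq : ContinuousAt (fun s : ℝ => ((T - s) / T) ^ α) t := by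
      refine ContinuousAt.rpow_const (by fun_prop) (Or.inl ?_)
      exact (div_pos (by linarith [ht.2]) hT).ne'
    exact ((Tendsto.mono_left hc hle).const_mul _).add
      ((hq.tendsto.mono_left nhdsWithin_le_nhds).mul hL)
end

section
/- Let T>0 and θ∈(0,1]. Then: (1) sup_{r∈[0,1)} sup_{n∈ℕ} sup_{u∈(0,b]} (2θn/T)·((ū_{τ_n^{θ,r}} ∧ b) − u) ≤ 2 for every b∈(0,T); (2) for every b∈(0,T) and every u∈(0,b), lim_{n→∞} (2θn/T) ∫_{[0,1)} ((ū_{τ_n^{θ,r}} ∧ b) − u) dr = ((T−u)/T)^{1−θ}; (3) for every b∈(0,T) and every D∈L_1([0,b]), lim_{n→∞} (2θn/T) ∫_0^b ((ū_{τ_n^θ} ∧ b) − u) D(u) du = ∫_0^b ((T−u)/T)^{1−θ} D(u) du. -/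
open MeasureTheory Filter Set

/-- The deterministic time net `τ_n^θ`: `t_{i,n}^θ := T − T(1 − i/n)^{1/θ}`. -/
noncomputable def detNet (T θ : ℝ) (n : ℕ) (i : ℕ) : ℝ :=
  T - T * (1 - (i : ℝ) / (n : ℝ)) ^ (1 / θ)

/-- The randomized time net `τ_n^{θ,r}` with knots
`0, r t₁, t₁ + r(t₂−t₁), …, t_{n−1} + r(T−t_{n−1}), T` (indices `0,…,n+1`). -/
noncomputable def randNet (T θ r : ℝ) (n : ℕ) (i : ℕ) : ℝ :=
  if i = 0 then 0
  else if i ≤ n then detNet T θ n (i - 1) + r * (detNet T θ n i - detNet T θ n (i - 1))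
  else T

/-- For a time net with knots `s 0 < s 1 < ⋯ < s m` and `u ∈ (0, s m]`, `ū_τ` is the smallest
knot that is `≥ u`, i.e. `ū_τ = s j` whenever `u ∈ (s (j−1), s j]`. -/
noncomputable def upKnot (s : ℕ → ℝ) (m : ℕ) (u : ℝ) : ℝ :=
  sInf {v : ℝ | (∃ j ≤ m, s j = v) ∧ u ≤ v}

lemma rpow_bds (p a b :ℝ) (hp: 1 ≤ p) (hb : 0 ≤ b) (hab : b ≤ a): p * b^(p-1)*(a-b) ≤ a^p-b^p ∧ a^p-b^p ≤ p*a^(p-1)*(a-b) := by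
  rcases hab.eq_or_lt with rfl | hab
  · simp
  obtain ⟨c, hc, h⟩ := exists_hasDerivAt_eq_slope (fun x:ℝ => x^p) (fun x => p*x^(p-1)) hab
    (by apply Continuous.continuousOn; exact Real.continuous_rpow_const (by linarith)) (fun x hx => Real.hasDerivAt_rpow_const (Or.inr hp))
  have h0 : 0 < a - b := by linarith
  rw [eq_div_iff h0.ne'] at h
  rw [← h]
  have h1 := Real.rpow_le_rpow hb hc.1.le (show 0 ≤ p-1 by linarith)
  have h2 := Real.rpow_le_rpow (hb.trans hc.1.le) hc.2.le (show 0 ≤ p-1 by linarith)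
  constructor <;> gcongr

lemma oneLeInvTh {θ : ℝ} (hθ : θ ∈ Set.Ioc (0:ℝ) 1) : 1 ≤ 1 / θ := by
  rw [le_div_iff₀ hθ.1]; linarith [hθ.2]

/-- normalized increment -/
noncomputable def incr (T θ : ℝ) (n k : ℕ) : ℝ := θ * n / T * (detNet T θ n (k+1) - detNet T θ n k)

lemma incr_bds {T θ : ℝ} (hT : 0 < T) (hθ : θ ∈ Set.Ioc (0:ℝ) 1) {n k : ℕ} (hk : k < n) :
    (1 - ((k:ℝ)+1)/n)^(1/θ-1) ≤ incr T θ n k ∧ incr T θ n k ≤ (1 - (k:ℝ)/n)^(1/θ-1) := by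
  have hn : (0:ℝ) < n := by exact_mod_cast (by omega : 0 < n)
  have hk' : (k:ℝ)+1 ≤ n := by exact_mod_cast hk
  have h := rpow_bds (1/θ) (1 - (k:ℝ)/n) (1 - ((k:ℝ)+1)/n) (oneLeInvTh hθ)
    (by rw [sub_nonneg, div_le_one hn]; exact hk') (by gcongr; linarith)
  have e : (1 - (k:ℝ)/n) - (1 - ((k:ℝ)+1)/n) = 1/n := by ring
  rw [e] at h
  have h0 := hθ.1
  have : incr T θ n k = θ * n * ((1 - (k:ℝ)/n)^(1/θ) - (1 - ((k:ℝ)+1)/n)^(1/θ)) := by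
    unfold incr detNet; push_cast; field_simp; ring
  rw [this]
  have hc : 0 ≤ θ * n := by positivity
  obtain ⟨h1, h2⟩ := h
  have h1 := mul_le_mul_of_nonneg_left h1 hc
  have h2 := mul_le_mul_of_nonneg_left h2 hc
  have e2 : ∀ z:ℝ, θ * n * (1/θ * z * (1/n)) = z := by intro z; field_simp
  rw [e2] at h1 h2
  exact ⟨h1, h2⟩

lemma incr_nonneg {T θ : ℝ} (hT : 0 < T) (hθ : θ ∈ Set.Ioc (0:ℝ) 1) {n k : ℕ} (hk : k < n) :
    0 ≤ incr T θ n k := by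
  refine le_trans ?_ (incr_bds hT hθ hk).1
  have hn : (0:ℝ) < n := by exact_mod_cast (by omega : 0 < n)
  have hk' : (k:ℝ)+1 ≤ n := by exact_mod_cast hk
  exact Real.rpow_nonneg (by rw [sub_nonneg, div_le_one hn]; exact hk') _

lemma incr_le_one {T θ : ℝ} (hT : 0 < T) (hθ : θ ∈ Set.Ioc (0:ℝ) 1) {n k : ℕ} (hk : k < n) :
    incr T θ n k ≤ 1 := by
  refine le_trans (incr_bds hT hθ hk).2 ?_
  have hn : (0:ℝ) < n := by exact_mod_cast (by omega : 0 < n)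
  have hk' : (k:ℝ)+1 ≤ n := by exact_mod_cast hk
  refine Real.rpow_le_one (by rw [sub_nonneg, div_le_one hn]; linarith) ?_ (by linarith [oneLeInvTh hθ])
  have : 0 ≤ (k:ℝ)/n := by positivity
  linarith

lemma det_step {T θ : ℝ} (hT : 0 < T) (hθ : θ ∈ Set.Ioc (0:ℝ) 1) {n k : ℕ} (hk : k < n) :
    detNet T θ n k ≤ detNet T θ n (k+1) ∧ detNet T θ n (k+1) - detNet T θ n k ≤ T / (θ * n) := by
  have hn : (0:ℝ) < n := by exact_mod_cast (by omega : 0 < n)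
  have h0 := hθ.1
  have h1 := incr_nonneg hT hθ hk
  have h2 := incr_le_one hT hθ hk
  have hc : 0 < θ * n / T := by positivity
  unfold incr at h1 h2
  constructor
  · have := nonneg_of_mul_nonneg_right h1 hc
    linarith
  · rw [← div_div, le_div_iff₀ hn, le_div_iff₀ h0]
    rw [div_mul_eq_mul_div, div_le_one hT] at h2
    linarith

lemma det_zero {T θ : ℝ} (n : ℕ) : detNet T θ n 0 = 0 := by simp [detNet]
lemma det_top {T θ : ℝ} (hθ : θ ∈ Set.Ioc (0:ℝ) 1) {n : ℕ} (hn : 1 ≤ n) : detNet T θ n n = T := by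
  have hn : (n:ℝ) ≠ 0 := by exact_mod_cast (by omega : n ≠ 0)
  have := hθ.1.ne'
  simp [detNet, hn, this]

lemma det_mono {T θ : ℝ} (hT : 0 < T) (hθ : θ ∈ Set.Ioc (0:ℝ) 1) {n i j : ℕ} (hij : i ≤ j) (hj : j ≤ n) :
    detNet T θ n i ≤ detNet T θ n j := by
  induction j, hij using Nat.le_induction with
  | base => exact le_rfl
  | succ j h ih => exact (ih (by omega)).trans (det_step hT hθ (by omega)).1

/-- inverse time change -/
noncomputable def xf (T θ u : ℝ) : ℝ := 1 - ((T-u)/T)^θ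

/-- the cell index -/
noncomputable def kf (T θ : ℝ) (n : ℕ) (u : ℝ) : ℕ := ⌈(n:ℝ) * xf T θ u⌉₊ - 1

lemma det_lt_iff {T θ : ℝ} (hT : 0 < T) (hθ : θ ∈ Set.Ioc (0:ℝ) 1) {n i : ℕ} (hn : 1 ≤ n) (hi : i ≤ n)
    {u : ℝ} (hu : u ≤ T) : detNet T θ n i < u ↔ (i:ℝ) < n * xf T θ u := by
  have hn : (0:ℝ) < n := by exact_mod_cast (by omega : 0 < n)
  have hi' : (i:ℝ) ≤ n := by exact_mod_cast hi
  have h1 : 0 ≤ (T-u)/T := div_nonneg (by linarith) hT.le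
  have h2 : 0 ≤ 1 - (i:ℝ)/n := by rw [sub_nonneg, div_le_one hn]; exact hi'
  have h := Real.lt_rpow_inv_iff_of_pos h1 h2 hθ.1
  unfold detNet xf
  rw [one_div]
  have e1 : T - T * (1 - (i:ℝ)/n)^θ⁻¹ < u ↔ (T-u)/T < (1 - (i:ℝ)/n)^θ⁻¹ := by
    rw [div_lt_iff₀ hT]; constructor <;> intro h <;> linarith
  rw [e1, h, mul_comm, ← div_lt_iff₀ hn]
  constructor <;> intro h <;> linarith

lemma xf_pos {T θ : ℝ} (hT : 0 < T) (hθ : θ ∈ Set.Ioc (0:ℝ) 1) {u : ℝ} (hu : u ∈ Set.Ioc 0 T) : 0 < xf T θ u := by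
  have h1 : 0 ≤ (T-u)/T := div_nonneg (by linarith [hu.2]) hT.le
  have : ((T-u)/T)^θ < 1 := Real.rpow_lt_one h1 (by rw [div_lt_one hT]; linarith [hu.1]) hθ.1
  unfold xf; linarith

lemma xf_le {T θ : ℝ} (hT : 0 < T) {u : ℝ} (hu : u ≤ T) : xf T θ u ≤ 1 := by
  have h1 : 0 ≤ (T-u)/T := div_nonneg (by linarith) hT.le
  have := Real.rpow_nonneg h1 θ
  unfold xf; linarith

lemma xf_lt {T θ : ℝ} (hT : 0 < T) {u : ℝ} (hu : u < T) : xf T θ u < 1 := by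
  have h1 : 0 < (T-u)/T := div_pos (by linarith) hT
  have := Real.rpow_pos_of_pos h1 θ
  unfold xf; linarith

lemma kf_x {T θ : ℝ} (hT : 0 < T) (hθ : θ ∈ Set.Ioc (0:ℝ) 1) {n : ℕ} (hn : 1 ≤ n)
    {u : ℝ} (hu : u ∈ Set.Ioc 0 T) : (kf T θ n u : ℝ) < n * xf T θ u ∧ n * xf T θ u ≤ kf T θ n u + 1 := by
  have hn : (0:ℝ) < n := by exact_mod_cast (by omega : 0 < n)
  have hp : 0 < n * xf T θ u := mul_pos hn (xf_pos hT hθ hu)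
  have h1 : 0 < ⌈(n:ℝ) * xf T θ u⌉₊ := Nat.ceil_pos.2 hp
  have e : kf T θ n u + 1 = ⌈(n:ℝ) * xf T θ u⌉₊ := by unfold kf; omega
  have e' : (kf T θ n u : ℝ) + 1 = ⌈(n:ℝ) * xf T θ u⌉₊ := by exact_mod_cast e
  have := Nat.ceil_lt_add_one hp.le
  have := Nat.le_ceil ((n:ℝ) * xf T θ u)
  constructor <;> linarith

lemma kf_spec {T θ : ℝ} (hT : 0 < T) (hθ : θ ∈ Set.Ioc (0:ℝ) 1) {n : ℕ} (hn : 1 ≤ n)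
    {u : ℝ} (hu : u ∈ Set.Ioc 0 T) : kf T θ n u < n ∧ detNet T θ n (kf T θ n u) < u ∧
      u ≤ detNet T θ n (kf T θ n u + 1) := by
  have h := kf_x hT hθ hn hu
  have hn' : (0:ℝ) < n := by exact_mod_cast (by omega : 0 < n)
  have hlt : kf T θ n u < n := by
    have : (kf T θ n u : ℝ) < n := by nlinarith [xf_le (θ := θ) hT hu.2]
    exact_mod_cast this
  refine ⟨hlt, (det_lt_iff hT hθ hn hlt.le hu.2).2 h.1, ?_⟩
  rw [← not_lt, det_lt_iff hT hθ hn hlt hu.2]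
  push_cast; linarith [h.2]

lemma kf_unique {T θ : ℝ} (hT : 0 < T) (hθ : θ ∈ Set.Ioc (0:ℝ) 1) {n : ℕ} (hn : 1 ≤ n)
    {u : ℝ} (hu : u ∈ Set.Ioc 0 T) {i : ℕ} (hi : i < n) (h1 : detNet T θ n i < u) (h2 : u ≤ detNet T θ n (i+1)) :
    kf T θ n u = i := by
  obtain ⟨h3, h4, h5⟩ := kf_spec hT hθ hn hu
  by_contra hne
  rcases lt_or_gt_of_ne hne with h | h
  · have := det_mono hT hθ (show kf T θ n u + 1 ≤ i by omega) hi.le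
    linarith
  · have := det_mono hT hθ (show i + 1 ≤ kf T θ n u by omega) h3.le
    linarith

lemma upKnot_eq {s : ℕ → ℝ} {m : ℕ} {u : ℝ} {j : ℕ} (hj : j + 1 ≤ m) (h1 : s j < u) (h2 : u ≤ s (j+1))
    (hs : ∀ i < m, s i ≤ s (i+1)) : upKnot s m u = s (j+1) := by
  have hmono : ∀ i k, i ≤ k → k ≤ m → s i ≤ s k := by
    intro i k hik
    induction k, hik using Nat.le_induction with
    | base => intro; exact le_rfl
    | succ j h ih => intro hm; exact (ih (by omega)).trans (hs j (by omega))
  refine IsLeast.csInf_eq ⟨⟨⟨j+1, hj, rfl⟩, h2⟩, ?_⟩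
  rintro v ⟨⟨i, hi, rfl⟩, hv⟩
  rcases Nat.lt_or_ge j i with h | h
  · exact hmono _ _ h hi
  · have := hmono i j h (by omega)
    linarith

lemma up_det {T θ : ℝ} (hT : 0 < T) (hθ : θ ∈ Set.Ioc (0:ℝ) 1) {n : ℕ} (hn : 1 ≤ n)
    {u : ℝ} (hu : u ∈ Set.Ioc 0 T) : upKnot (detNet T θ n) n u = detNet T θ n (kf T θ n u + 1) := by
  obtain ⟨h3, h4, h5⟩ := kf_spec hT hθ hn hu
  exact upKnot_eq h3 h4 h5 (fun i hi => (det_step hT hθ hi).1)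

lemma rand_succ {T θ r : ℝ} {n i : ℕ} (hi : i < n) :
    randNet T θ r n (i+1) = detNet T θ n i + r * (detNet T θ n (i+1) - detNet T θ n i) := by
  simp [randNet, hi]

lemma rand_le {T θ r : ℝ} (hT : 0 < T) (hθ : θ ∈ Set.Ioc (0:ℝ) 1) (hr : r ∈ Set.Icc (0:ℝ) 1) {n i : ℕ}
    (hi : i ≤ n) : randNet T θ r n i ≤ detNet T θ n i := by
  rcases i with _ | i
  · simp [randNet, det_zero]
  · rw [rand_succ hi]
    nlinarith [(det_step hT hθ hi).1, hr.1, hr.2]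

lemma le_rand {T θ r : ℝ} (hT : 0 < T) (hθ : θ ∈ Set.Ioc (0:ℝ) 1) (hr : r ∈ Set.Icc (0:ℝ) 1) {n i : ℕ}
    (hn : 1 ≤ n) (hi : i ≤ n) : detNet T θ n i ≤ randNet T θ r n (i+1) := by
  rcases hi.eq_or_lt with rfl | hi
  · simp [randNet, det_top hθ hn]
  · rw [rand_succ hi]
    nlinarith [(det_step hT hθ hi).1, hr.1, hr.2]

lemma up_rand1 {T θ r : ℝ} (hT : 0 < T) (hθ : θ ∈ Set.Ioc (0:ℝ) 1) (hr : r ∈ Set.Icc (0:ℝ) 1) {n k : ℕ}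
    (hk : k < n) {u : ℝ} (h1 : detNet T θ n k < u) (h2 : u ≤ randNet T θ r n (k+1)) :
    upKnot (randNet T θ r n) (n+1) u = randNet T θ r n (k+1) := by
  refine upKnot_eq (by omega) ((rand_le hT hθ hr hk.le).trans_lt h1) h2 ?_
  intro i hi
  exact (rand_le hT hθ hr (by omega)).trans (le_rand hT hθ hr (by omega) (by omega))

lemma up_rand2 {T θ r : ℝ} (hT : 0 < T) (hθ : θ ∈ Set.Ioc (0:ℝ) 1) (hr : r ∈ Set.Icc (0:ℝ) 1) {n k : ℕ}
    (hk : k < n) {u : ℝ} (h1 : u ≤ detNet T θ n (k+1)) (h2 : randNet T θ r n (k+1) < u) :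
    upKnot (randNet T θ r n) (n+1) u = randNet T θ r n (k+2) := by
  refine upKnot_eq (by omega) h2 (h1.trans (le_rand hT hθ hr (by omega) (by omega))) ?_
  intro i hi
  exact (rand_le hT hθ hr (by omega)).trans (le_rand hT hθ hr (by omega) (by omega))

lemma part1 {T θ : ℝ} (hT : 0 < T) (hθ : θ ∈ Set.Ioc (0:ℝ) 1) :
    ∀ b ∈ Set.Ioo (0:ℝ) T, ∀ r ∈ Set.Ico (0:ℝ) 1, ∀ n : ℕ, 1 ≤ n →
      ∀ u ∈ Set.Ioc (0:ℝ) b,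
        2 * θ * (n : ℝ) / T * (min (upKnot (randNet T θ r n) (n + 1) u) b - u) ≤ 2 := by
  intro b hb r hr n hn u hu
  have hr' : r ∈ Set.Icc (0:ℝ) 1 := ⟨hr.1, hr.2.le⟩
  have hn' : (0:ℝ) < n := by exact_mod_cast (by omega : 0 < n)
  have h0 := hθ.1
  obtain ⟨h3, h4, h5⟩ := kf_spec hT hθ hn (u := u) ⟨hu.1, by linarith [hu.2, hb.2]⟩
  set k := kf T θ n u
  have hs := det_step hT hθ h3
  suffices h : upKnot (randNet T θ r n) (n + 1) u - u ≤ T / (θ * n) by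
    have h' : min (upKnot (randNet T θ r n) (n + 1) u) b - u ≤ T / (θ * n) :=
      (sub_le_sub_right (min_le_left _ _) _).trans h
    have := mul_le_mul_of_nonneg_left h' (show 0 ≤ 2 * θ * (n : ℝ) / T by positivity)
    refine this.trans (le_of_eq ?_)
    field_simp
  rcases le_or_gt u (randNet T θ r n (k+1)) with h | h
  · rw [up_rand1 hT hθ hr' h3 h4 h]
    have := rand_le hT hθ hr' (show k+1 ≤ n from h3)
    linarith
  · rw [up_rand2 hT hθ hr' h3 h5 h]
    have e := rand_succ (T := T) (θ := θ) (r := r) h3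
    rcases (show k+1 ≤ n from h3).eq_or_lt with h6 | h6
    · have e2 : randNet T θ r n (k+2) = detNet T θ n (k+1) := by
        rw [h6, det_top hθ hn]; simp [randNet]; omega
      have : 0 ≤ r * (detNet T θ n (k+1) - detNet T θ n k) := mul_nonneg hr.1 (by linarith)
      linarith
    · have e2 := rand_succ (T := T) (θ := θ) (r := r) h6
      have hs2 := det_step hT hθ h6
      nlinarith [hr.1, hr.2]
lemma limExpEq {T θ u : ℝ} (hT : 0 < T) (hθ : θ ∈ Set.Ioc (0:ℝ) 1) (hu : u < T) :
    (1 - xf T θ u)^(1/θ-1) = ((T-u)/T)^(1-θ) := by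
  have h1 : 0 ≤ (T-u)/T := div_nonneg (by linarith) hT.le
  have h0 := hθ.1.ne'
  unfold xf
  rw [sub_sub_cancel, ← Real.rpow_mul h1]
  congr 1
  field_simp

lemma incr_tendsto {T θ : ℝ} (hT : 0 < T) (hθ : θ ∈ Set.Ioc (0:ℝ) 1) {x : ℝ} (hx : x < 1) {k : ℕ → ℕ}
    (hk : ∀ᶠ n in atTop, k n < n) (h : Tendsto (fun n => (k n : ℝ) / n) atTop (nhds x)) :
    Tendsto (fun n => incr T θ n (k n)) atTop (nhds ((1-x)^(1/θ-1))) := by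
  have hz : Tendsto (fun n : ℕ => (1:ℝ)/n) atTop (nhds 0) := tendsto_one_div_atTop_nhds_zero_nat
  have h' : Tendsto (fun n => ((k n : ℝ) + 1) / n) atTop (nhds x) := by
    have := h.add hz
    simp only [add_zero] at this
    refine this.congr fun n => by ring
  have hne : (1 - x) ≠ 0 := by linarith
  have t1 : Tendsto (fun n => (1 - ((k n : ℝ) + 1) / n)^(1/θ-1)) atTop (nhds ((1-x)^(1/θ-1))) :=
    (tendsto_const_nhds.sub h').rpow_const (Or.inl hne)
  have t2 : Tendsto (fun n => (1 - (k n : ℝ) / n)^(1/θ-1)) atTop (nhds ((1-x)^(1/θ-1))) :=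
    (tendsto_const_nhds.sub h).rpow_const (Or.inl hne)
  refine tendsto_of_tendsto_of_tendsto_of_le_of_le' t1 t2 ?_ ?_
  · filter_upwards [hk] with n hn using (incr_bds hT hθ hn).1
  · filter_upwards [hk] with n hn using (incr_bds hT hθ hn).2

lemma kf_tendsto {T θ : ℝ} (hT : 0 < T) (hθ : θ ∈ Set.Ioc (0:ℝ) 1) {u : ℝ} (hu : u ∈ Set.Ioc 0 T) :
    Tendsto (fun n => (kf T θ n u : ℝ) / n) atTop (nhds (xf T θ u)) := by
  have hz : Tendsto (fun n : ℕ => (1:ℝ)/n) atTop (nhds 0) := tendsto_one_div_atTop_nhds_zero_nat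
  have t1 : Tendsto (fun n : ℕ => xf T θ u - 1/n) atTop (nhds (xf T θ u)) := by
    simpa using tendsto_const_nhds.sub hz
  refine tendsto_of_tendsto_of_tendsto_of_le_of_le' t1 tendsto_const_nhds ?_ ?_
  · filter_upwards [eventually_ge_atTop 1] with n hn
    have hn' : (0:ℝ) < n := by exact_mod_cast (by omega : 0 < n)
    have := (kf_x hT hθ hn hu).2
    rw [sub_le_iff_le_add, ← add_div, le_div_iff₀ hn']
    linarith
  · filter_upwards [eventually_ge_atTop 1] with n hn
    have hn' : (0:ℝ) < n := by exact_mod_cast (by omega : 0 < n)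
    have := (kf_x hT hθ hn hu).1
    rw [div_le_iff₀ hn']
    linarith

lemma kf_room {T θ : ℝ} (hT : 0 < T) (hθ : θ ∈ Set.Ioc (0:ℝ) 1) {u : ℝ} (hu : u ∈ Set.Ioo 0 T) :
    ∀ᶠ n in atTop, kf T θ n u + 1 < n := by
  have hx := xf_lt (θ := θ) hT hu.2
  have h0 : 0 < 1 - xf T θ u := by linarith
  filter_upwards [eventually_ge_atTop 1, tendsto_natCast_atTop_atTop.eventually_gt_atTop (1 / (1 - xf T θ u))] with n hn h
  have := (kf_x hT hθ hn (u := u) ⟨hu.1, hu.2.le⟩).1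
  rw [div_lt_iff₀ h0] at h
  have : (kf T θ n u : ℝ) + 1 < n := by linarith
  exact_mod_cast this

lemma mesh_tendsto {T θ : ℝ} : Tendsto (fun n : ℕ => T / (θ * n)) atTop (nhds 0) := by
  have hz : Tendsto (fun n : ℕ => (1:ℝ)/n) atTop (nhds 0) := tendsto_one_div_atTop_nhds_zero_nat
  have := hz.const_mul (T/θ)
  simp only [mul_zero] at this
  refine this.congr fun n => by rw [div_mul_div_comm, mul_one]

lemma saw_integral {f : ℝ → ℝ} {A d d' u ρ : ℝ} (hρ : ρ ∈ Set.Icc (0:ℝ) 1) (hu : u = A + ρ * d)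
    (h1 : ∀ r ∈ Set.Ioo 0 ρ, f r = A + d + r * d' - u) (h2 : ∀ r ∈ Set.Ioo ρ 1, f r = A + r * d - u) :
    ∫ r in (0:ℝ)..1, f r = (d + ρ^2 * (d' - d)) / 2 := by
  have c1 : Set.EqOn (fun r => A + d + r * d' - u) f (Set.uIoo 0 ρ) := by
    rw [Set.uIoo_of_le hρ.1]; intro r hr; exact (h1 r hr).symm
  have c2 : Set.EqOn (fun r => A + r * d - u) f (Set.uIoo ρ 1) := by
    rw [Set.uIoo_of_le hρ.2]; intro r hr; exact (h2 r hr).symm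
  have i1 : IntervalIntegrable f volume 0 ρ :=
    IntervalIntegrable.congr_uIoo (Continuous.intervalIntegrable (by fun_prop) _ _) c1
  have i2 : IntervalIntegrable f volume ρ 1 :=
    IntervalIntegrable.congr_uIoo (Continuous.intervalIntegrable (by fun_prop) _ _) c2
  rw [← intervalIntegral.integral_add_adjacent_intervals i1 i2,
    ← intervalIntegral.integral_congr_uIoo c1, ← intervalIntegral.integral_congr_uIoo c2]
  have key : ∀ a b c e : ℝ, ∫ r in a..b, (c + r * e) = c * (b - a) + e * (b^2-a^2)/2 := by
    intro a b c e
    rw [intervalIntegral.integral_add (by simp) (Continuous.intervalIntegrable (by fun_prop) _ _)]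
    simp only [intervalIntegral.integral_const, intervalIntegral.integral_mul_const, integral_id, smul_eq_mul]
    ring
  have e1 := key 0 ρ (A+d-u) d'
  have e2 := key ρ 1 (A-u) d
  rw [show (fun r => A + d + r * d' - u) = (fun r => A + d - u + r * d') by ext; ring, e1,
    show (fun r => A + r * d - u) = (fun r => A - u + r * d) by ext; ring, e2, hu]
  ring

lemma part2 {T θ : ℝ} (hT : 0 < T) (hθ : θ ∈ Set.Ioc (0:ℝ) 1) :
    ∀ b ∈ Set.Ioo (0:ℝ) T, ∀ u ∈ Set.Ioo (0:ℝ) b,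
      Filter.Tendsto
        (fun n : ℕ => 2 * θ * (n : ℝ) / T *
          ∫ r in (0:ℝ)..1, (min (upKnot (randNet T θ r n) (n + 1) u) b - u))
        Filter.atTop (nhds (((T - u) / T) ^ (1 - θ))) := by
  intro b hb u hu
  have h0 := hθ.1
  have hu' : u ∈ Set.Ioo 0 T := ⟨hu.1, by linarith [hu.2, hb.2]⟩
  have hu'' : u ∈ Set.Ioc 0 T := ⟨hu'.1, hu'.2.le⟩
  have hx := xf_lt (θ := θ) hT hu'.2
  have hz : Tendsto (fun n : ℕ => (1:ℝ)/n) atTop (nhds 0) := tendsto_one_div_atTop_nhds_zero_nat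
  have hroom := kf_room hT hθ hu'
  have hk := kf_tendsto hT hθ hu''
  have g1 := incr_tendsto hT hθ hx (hroom.mono fun n h => by omega) hk
  have g2 := incr_tendsto hT hθ hx (k := fun n => kf T θ n u + 1) hroom (by
    have := hk.add hz
    simp only [add_zero] at this
    refine this.congr fun n => by push_cast; ring)
  rw [limExpEq hT hθ hu'.2] at g1 g2
  let ρ : ℕ → ℝ := fun n => (u - detNet T θ n (kf T θ n u)) /
    (detNet T θ n (kf T θ n u + 1) - detNet T θ n (kf T θ n u))
  have hρ : ∀ n, 1 ≤ n → ρ n ∈ Set.Icc (0:ℝ) 1 := by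
    intro n hn
    obtain ⟨h3, h4, h5⟩ := kf_spec hT hθ hn hu''
    exact ⟨div_nonneg (by linarith) (by linarith), (div_le_one (by linarith)).2 (by linarith)⟩
  have main : Tendsto (fun n => incr T θ n (kf T θ n u) +
      (incr T θ n (kf T θ n u + 1) - incr T θ n (kf T θ n u)) * (ρ n)^2) atTop
      (nhds (((T - u) / T) ^ (1 - θ))) := by
    have := g2.sub g1
    rw [sub_self] at this
    have := this.zero_mul_isBoundedUnder_le (g := fun n => (ρ n)^2) (by
      refine Filter.isBoundedUnder_of_eventually_le (a := 1) ?_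
      filter_upwards [eventually_ge_atTop 1] with n hn
      have := hρ n hn
      simp only [Function.comp, Real.norm_eq_abs, abs_pow, sq_abs]
      exact pow_le_one₀ this.1 this.2)
    simpa using g1.add this
  refine main.congr' ?_
  have hm : ∀ᶠ n : ℕ in atTop, T / (θ * n) < (b - u)/2 :=
    mesh_tendsto.eventually_lt_const (by linarith [hu.2])
  filter_upwards [hroom, hm, eventually_ge_atTop 1] with n hr hm hn
  obtain ⟨h3, h4, h5⟩ := kf_spec hT hθ hn hu''
  have hρn := hρ n hn
  have hρe : ρ n = (u - detNet T θ n (kf T θ n u)) /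
    (detNet T θ n (kf T θ n u + 1) - detNet T θ n (kf T θ n u)) := rfl
  unfold incr
  generalize ρ n = p at *
  set k := kf T θ n u
  have s1 := det_step hT hθ h3
  have s2 := det_step hT hθ hr
  have hd : 0 < detNet T θ n (k+1) - detNet T θ n k := by linarith
  have hue : u = detNet T θ n k + p * (detNet T θ n (k+1) - detNet T θ n k) := by
    rw [hρe, div_mul_cancel₀ _ hd.ne']; ring
  rw [saw_integral hρn hue (d' := detNet T θ n (k+2) - detNet T θ n (k+1))]
  · have hn' : (0:ℝ) < n := by exact_mod_cast (by omega : 0 < n)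
    field_simp
  · intro r hr'
    have hrI : r ∈ Set.Icc (0:ℝ) 1 := ⟨hr'.1.le, by linarith [hr'.2, hρn.2]⟩
    have e := rand_succ (T := T) (θ := θ) (r := r) h3
    have e2 := rand_succ (T := T) (θ := θ) (r := r) hr
    have hle := rand_le hT hθ hrI (show k + 2 ≤ n from hr)
    have : randNet T θ r n (k+1) < u := by
      rw [e]
      have := mul_lt_mul_of_pos_right hr'.2 hd
      linarith
    rw [up_rand2 hT hθ hrI h3 h5 this, min_eq_left, e2]
    · ring
    · have s2' := s2.2
      rw [show k + 1 + 1 = k + 2 from rfl] at s2'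
      linarith
  · intro r hr'
    have hrI : r ∈ Set.Icc (0:ℝ) 1 := ⟨by linarith [hr'.1, hρn.1], hr'.2.le⟩
    have e := rand_succ (T := T) (θ := θ) (r := r) h3
    have hle := rand_le hT hθ hrI (show k + 1 ≤ n from h3)
    have : u ≤ randNet T θ r n (k+1) := by
      rw [e]
      have := mul_lt_mul_of_pos_right hr'.1 hd
      linarith
    rw [up_rand1 hT hθ hrI h3 h4 this, min_eq_left, e]
    linarith
/-- centred sawtooth -/
noncomputable def wf (T θ : ℝ) (n : ℕ) (u : ℝ) : ℝ :=
  θ * n / T * (2 * (detNet T θ n (kf T θ n u + 1) - u)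
    - (detNet T θ n (kf T θ n u + 1) - detNet T θ n (kf T θ n u)))

lemma kf_meas (T θ : ℝ) (n : ℕ) : Measurable (kf T θ n) := by
  have h1 : Measurable (fun u => (n:ℝ) * xf T θ u) := by unfold xf; fun_prop
  have h2 : Measurable (fun m : ℕ => m - 1) := measurable_from_top
  exact h2.comp (Nat.measurable_ceil.comp h1)

lemma det_kf_meas (T θ : ℝ) (n : ℕ) (c : ℕ) : Measurable (fun u => detNet T θ n (kf T θ n u + c)) := by
  have h2 : Measurable (fun m : ℕ => detNet T θ n (m + c)) := measurable_from_top
  exact h2.comp (kf_meas T θ n)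

lemma wf_meas (T θ : ℝ) (n : ℕ) : Measurable (wf T θ n) := by
  have h1 := det_kf_meas T θ n 1
  have h0 := det_kf_meas T θ n 0
  simp only [add_zero] at h0
  unfold wf
  exact (((h1.sub measurable_id).const_mul 2).sub (h1.sub h0)).const_mul _

lemma wf_bd {T θ : ℝ} (hT : 0 < T) (hθ : θ ∈ Set.Ioc (0:ℝ) 1) {n : ℕ} (hn : 1 ≤ n)
    {u : ℝ} (hu : u ∈ Set.Ioc 0 T) : |wf T θ n u| ≤ 1 := by
  obtain ⟨h3, h4, h5⟩ := kf_spec hT hθ hn hu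
  have h0 := hθ.1
  have hc : 0 ≤ θ * n / T := by positivity
  refine le_trans ?_ (incr_le_one hT hθ h3)
  unfold wf incr
  rw [abs_mul, abs_of_nonneg hc]
  refine mul_le_mul_of_nonneg_left ?_ hc
  rw [abs_le]; constructor <;> linarith

lemma wf_int {T θ : ℝ} (hT : 0 < T) (hθ : θ ∈ Set.Ioc (0:ℝ) 1) {n : ℕ} (hn : 1 ≤ n)
    {f : ℝ → ℝ} {s : Set ℝ} (hs : MeasurableSet s) (hsT : s ⊆ Set.Ioc 0 T) (hf : IntegrableOn f s) :
    IntegrableOn (fun u => wf T θ n u * f u) s := by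
  refine Integrable.bdd_mul (c := 1) hf (wf_meas T θ n).aestronglyMeasurable ?_
  filter_upwards [ae_restrict_mem hs] with u hu
  exact wf_bd hT hθ hn (hsT hu)

lemma wf_cont {T θ : ℝ} (hT : 0 < T) (hθ : θ ∈ Set.Ioc (0:ℝ) 1) {n : ℕ} (hn : 1 ≤ n)
    {g : ℝ → ℝ} (hg : Continuous g) {δ η : ℝ} (hη : T / (θ * n) < η)
    (hu : ∀ x y, |x - y| < η → |g x - g y| ≤ δ) :
    |∫ u in (0:ℝ)..T, wf T θ n u * g u| ≤ δ * T := by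
  have hsub : ∀ k < n, Set.Ioc (detNet T θ n k) (detNet T θ n (k+1)) ⊆ Set.Ioc 0 T := by
    intro k hk
    have a := det_mono hT hθ (Nat.zero_le k) hk.le
    have b := det_mono hT hθ (show k + 1 ≤ n from hk) le_rfl
    rw [det_zero] at a
    rw [det_top hθ hn] at b
    exact Set.Ioc_subset_Ioc a b
  have hii : ∀ k < n, IntervalIntegrable (fun u => wf T θ n u * g u) volume (detNet T θ n k) (detNet T θ n (k+1)) := by
    intro k hk
    rw [intervalIntegrable_iff_integrableOn_Ioc_of_le (det_step hT hθ hk).1]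
    exact wf_int hT hθ hn measurableSet_Ioc (hsub k hk)
      ((hg.integrableOn_Icc).mono_set Set.Ioc_subset_Icc_self)
  have hsum := intervalIntegral.sum_integral_adjacent_intervals hii
  rw [det_zero, det_top hθ hn] at hsum
  rw [← hsum]
  refine (Finset.abs_sum_le_sum_abs _ _).trans ?_
  have hcell : ∀ k ∈ Finset.range n, |∫ u in (detNet T θ n k)..(detNet T θ n (k+1)), wf T θ n u * g u| ≤
      δ * (detNet T θ n (k+1) - detNet T θ n k) := by
    intro k hk
    rw [Finset.mem_range] at hk
    have hst := det_step hT hθ hk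
    set A := detNet T θ n k with hA
    set B := detNet T θ n (k+1) with hB
    have hw : ∀ u ∈ Set.Ioc A B, wf T θ n u = θ * n / T * (2 * (B - u) - (B - A)) := by
      intro u hu
      have := kf_unique hT hθ hn (hsub k hk hu) hk hu.1 hu.2
      unfold wf; rw [this]
    have hzero : ∫ u in A..B, wf T θ n u * g A = 0 := by
      rw [intervalIntegral.integral_mul_const]
      have : ∫ u in A..B, wf T θ n u = ∫ u in A..B, θ * n / T * (2 * (B - u) - (B - A)) := by
        refine intervalIntegral.integral_congr_ae (Filter.Eventually.of_forall ?_)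
        rw [Set.uIoc_of_le hst.1]
        exact hw
      rw [this, intervalIntegral.integral_const_mul]
      have : ∫ u in A..B, (2 * (B - u) - (B - A)) = 0 := by
        rw [show (fun u => 2 * (B - u) - (B - A)) = fun u => (B + A) - u * 2 by ext; ring]
        rw [intervalIntegral.integral_sub (by simp) (Continuous.intervalIntegrable (by fun_prop) _ _)]
        simp only [intervalIntegral.integral_const, intervalIntegral.integral_mul_const, integral_id, smul_eq_mul]
        ring
      rw [this]; simp
    have hi0 : IntervalIntegrable (fun u => wf T θ n u * g A) volume A B := by
      rw [intervalIntegrable_iff_integrableOn_Ioc_of_le hst.1]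
      exact wf_int hT hθ hn measurableSet_Ioc (hsub k hk)
        ((continuous_const.integrableOn_Icc).mono_set Set.Ioc_subset_Icc_self)
    have e : ∫ u in A..B, wf T θ n u * g u = ∫ u in A..B, wf T θ n u * (g u - g A) := by
      simp only [mul_sub]
      rw [intervalIntegral.integral_sub (hii k hk) hi0, hzero, sub_zero]
    rw [e]
    have := intervalIntegral.norm_integral_le_of_norm_le_const (C := δ) (a := A) (b := B)
      (f := fun u => wf T θ n u * (g u - g A)) (by
        rw [Set.uIoc_of_le hst.1]
        intro u huu
        have h1 := wf_bd hT hθ hn (hsub k hk huu)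
        have h2 := hu u A (by rw [abs_of_nonneg (by linarith [huu.1])]; linarith [huu.2])
        rw [Real.norm_eq_abs, abs_mul]
        have := abs_nonneg (g u - g A)
        nlinarith)
    rw [abs_of_nonneg (by linarith : 0 ≤ B - A)] at this
    exact this
  refine (Finset.sum_le_sum hcell).trans ?_
  rw [← Finset.mul_sum, Finset.sum_range_sub, det_zero, det_top hθ hn, sub_zero]

lemma wf_weak {T θ : ℝ} (hT : 0 < T) (hθ : θ ∈ Set.Ioc (0:ℝ) 1) {f : ℝ → ℝ} (hf : Integrable f) :
    Tendsto (fun n => ∫ u in Set.Ioc 0 T, wf T θ n u * f u) atTop (nhds 0) := by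
  rw [Metric.tendsto_atTop']
  intro ε hε
  obtain ⟨g, hgc, hg1, hg2, hg3⟩ := hf.exists_hasCompactSupport_integral_sub_le (half_pos hε)
  have huc := hgc.uniformContinuous_of_continuous hg2
  obtain ⟨η, hη, hu⟩ := Metric.uniformContinuous_iff.1 huc (ε / 4 / T) (by positivity)
  have hm : ∀ᶠ n : ℕ in atTop, T / (θ * n) < η := mesh_tendsto.eventually_lt_const hη
  obtain ⟨N, hN⟩ := eventually_atTop.1 (hm.and (eventually_ge_atTop 1))
  refine ⟨N, fun n hn => ?_⟩
  obtain ⟨hm, hn⟩ := hN n hn.le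
  have h1 := wf_cont hT hθ hn hg2 hm (δ := ε/4/T) (fun x y h => (hu (a := x) (b := y) h).le)
  rw [intervalIntegral.integral_of_le hT.le, div_mul_cancel₀ _ hT.ne'] at h1
  have i1 := wf_int hT hθ hn measurableSet_Ioc subset_rfl hf.integrableOn
  have i2 := wf_int hT hθ hn measurableSet_Ioc subset_rfl hg3.integrableOn
  have h2 : |∫ u in Set.Ioc 0 T, (wf T θ n u * f u - wf T θ n u * g u)| ≤ ε/2 := by
    refine le_trans ?_ hg1
    have hn1 : IntegrableOn (fun u => ‖f u - g u‖) (Set.Ioc 0 T) := (hf.sub hg3).norm.integrableOn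
    rw [← Real.norm_eq_abs]
    refine (norm_integral_le_of_norm_le hn1 ?_).trans ?_
    · filter_upwards [ae_restrict_mem measurableSet_Ioc] with u hu
      have := wf_bd hT hθ hn hu
      rw [← mul_sub, norm_mul]
      exact mul_le_of_le_one_left (norm_nonneg _) this
    · exact setIntegral_le_integral (hf.sub hg3).norm (Filter.Eventually.of_forall fun u => norm_nonneg _)
  rw [integral_sub i1 i2] at h2
  rw [dist_zero_right, Real.norm_eq_abs]
  rw [abs_le] at h1 h2
  rw [abs_lt]
  constructor <;> linarith [h1.1, h1.2, h2.1, h2.2]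

/-- remaining part -/
noncomputable def vf (T θ b : ℝ) (n : ℕ) (u : ℝ) : ℝ :=
  incr T θ n (kf T θ n u) +
    2 * (θ * n / T) * (min (detNet T θ n (kf T θ n u + 1)) b - detNet T θ n (kf T θ n u + 1))

lemma vf_meas (T θ b : ℝ) (n : ℕ) : Measurable (vf T θ b n) := by
  have h1 := det_kf_meas T θ n 1
  have h0 := det_kf_meas T θ n 0
  simp only [add_zero] at h0
  unfold vf incr
  exact ((h1.sub h0).const_mul _).add (((h1.min measurable_const).sub h1).const_mul _)

lemma vf_bd {T θ b : ℝ} (hT : 0 < T) (hθ : θ ∈ Set.Ioc (0:ℝ) 1) (hb : b < T) {n : ℕ} (hn : 1 ≤ n)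
    {u : ℝ} (hu : u ∈ Set.Ioc 0 b) : |vf T θ b n u| ≤ 3 := by
  obtain ⟨h3, h4, h5⟩ := kf_spec hT hθ hn (u := u) ⟨hu.1, by linarith [hu.2]⟩
  have h0 := hθ.1
  have hc : 0 ≤ θ * n / T := by positivity
  have a := incr_nonneg hT hθ h3
  have b' := incr_le_one hT hθ h3
  have c : min (detNet T θ n (kf T θ n u + 1)) b - detNet T θ n (kf T θ n u + 1) ≤ 0 := by
    linarith [min_le_left (detNet T θ n (kf T θ n u + 1)) b]
  have d : -(detNet T θ n (kf T θ n u + 1) - detNet T θ n (kf T θ n u)) ≤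
      min (detNet T θ n (kf T θ n u + 1)) b - detNet T θ n (kf T θ n u + 1) := by
    have := le_min h5 hu.2
    linarith
  have c' := mul_le_mul_of_nonneg_left c hc
  have d' := mul_le_mul_of_nonneg_left d hc
  unfold vf
  unfold incr at *
  rw [abs_le]; constructor <;> linarith

lemma vf_tendsto {T θ b : ℝ} (hT : 0 < T) (hθ : θ ∈ Set.Ioc (0:ℝ) 1) (hb : b < T)
    {u : ℝ} (hu : u ∈ Set.Ioo 0 b) :
    Tendsto (fun n => vf T θ b n u) atTop (nhds (((T-u)/T)^(1-θ))) := by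
  have hu' : u ∈ Set.Ioo 0 T := ⟨hu.1, by linarith [hu.2, hb]⟩
  have hu'' : u ∈ Set.Ioc 0 T := ⟨hu'.1, hu'.2.le⟩
  have g1 := incr_tendsto hT hθ (xf_lt (θ := θ) hT hu'.2)
    ((kf_room hT hθ hu').mono fun n h => by omega) (kf_tendsto hT hθ hu'')
  rw [limExpEq hT hθ hu'.2] at g1
  refine g1.congr' ?_
  have hm : ∀ᶠ n : ℕ in atTop, T / (θ * n) < b - u :=
    mesh_tendsto.eventually_lt_const (by linarith [hu.2])
  filter_upwards [hm, eventually_ge_atTop 1] with n hm hn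
  obtain ⟨h3, h4, h5⟩ := kf_spec hT hθ hn hu''
  have := det_step hT hθ h3
  unfold vf
  rw [min_eq_left (by linarith), sub_self, mul_zero, add_zero]

lemma part3 {T θ : ℝ} (hT : 0 < T) (hθ : θ ∈ Set.Ioc (0:ℝ) 1) :
    ∀ b ∈ Set.Ioo (0:ℝ) T, ∀ D : ℝ → ℝ, IntegrableOn D (Set.Icc 0 b) →
      Filter.Tendsto
        (fun n : ℕ => 2 * θ * (n : ℝ) / T *
          ∫ u in (0:ℝ)..b, (min (upKnot (detNet T θ n) n u) b - u) * D u)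
        Filter.atTop (nhds (∫ u in (0:ℝ)..b, ((T - u) / T) ^ (1 - θ) * D u)) := by
  intro b hb D hD
  have hD' : IntegrableOn D (Set.Ioc 0 b) := hD.mono_set Set.Ioc_subset_Icc_self
  have hsub : Set.Ioc 0 b ⊆ Set.Ioc 0 T := Set.Ioc_subset_Ioc le_rfl hb.2.le
  have hind : Integrable ((Set.Ioc 0 b).indicator D) := hD'.integrable_indicator measurableSet_Ioc
  have t1 := wf_weak hT hθ hind
  have t1' : Tendsto (fun n => ∫ u in Set.Ioc 0 b, wf T θ n u * D u) atTop (nhds 0) := by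
    refine t1.congr fun n => ?_
    simp_rw [← Set.indicator_mul_right (Set.Ioc 0 b) (fun u => wf T θ n u)]
    rw [setIntegral_indicator measurableSet_Ioc, Set.inter_eq_self_of_subset_right hsub]
  have t2 : Tendsto (fun n => ∫ u in Set.Ioc 0 b, vf T θ b n u * D u) atTop
      (nhds (∫ u in Set.Ioc 0 b, ((T - u) / T) ^ (1 - θ) * D u)) := by
    refine tendsto_integral_filter_of_dominated_convergence (fun u => 3 * ‖D u‖) ?_ ?_ (hD'.norm.const_mul 3) ?_
    · exact Filter.Eventually.of_forall fun n =>
        (vf_meas T θ b n).aestronglyMeasurable.mul hD'.aestronglyMeasurable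
    · filter_upwards [eventually_ge_atTop 1] with n hn
      filter_upwards [ae_restrict_mem measurableSet_Ioc] with u hu
      rw [norm_mul]
      exact mul_le_mul_of_nonneg_right (vf_bd hT hθ hb.2 hn hu) (norm_nonneg _)
    · have hne : ∀ᵐ u ∂(volume.restrict (Set.Ioc 0 b)), u ≠ b :=
        ae_restrict_of_ae (Measure.ae_ne volume b)
      filter_upwards [ae_restrict_mem measurableSet_Ioc, hne] with u hu hne
      exact (vf_tendsto hT hθ hb.2 ⟨hu.1, lt_of_le_of_ne hu.2 hne⟩).mul_const _
  have t := t1'.add t2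
  rw [zero_add] at t
  rw [intervalIntegral.integral_of_le hb.1.le]
  refine t.congr' ?_
  filter_upwards [eventually_ge_atTop 1] with n hn
  have i1 := wf_int hT hθ hn measurableSet_Ioc hsub hD'
  have i2 : IntegrableOn (fun u => vf T θ b n u * D u) (Set.Ioc 0 b) := by
    refine Integrable.bdd_mul (c := 3) hD' (vf_meas T θ b n).aestronglyMeasurable ?_
    filter_upwards [ae_restrict_mem measurableSet_Ioc] with u hu
    exact vf_bd hT hθ hb.2 hn hu
  rw [← integral_add i1 i2, intervalIntegral.integral_of_le hb.1.le, ← integral_const_mul]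
  refine setIntegral_congr_fun measurableSet_Ioc fun u hu => ?_
  rw [up_det hT hθ hn (hsub hu)]
  unfold wf vf incr
  ring

/-- Convergence of the time-net quantities:
(1) `(2θn/T)((ū_{τ_n^{θ,r}} ∧ b) − u) ≤ 2` uniformly;
(2) `(2θn/T)∫_{[0,1)}((ū_{τ_n^{θ,r}} ∧ b) − u) dr → ((T−u)/T)^{1−θ}`;
(3) `(2θn/T)∫_0^b ((ū_{τ_n^θ} ∧ b) − u) D(u) du → ∫_0^b ((T−u)/T)^{1−θ} D(u) du`
for `D ∈ L_1([0,b])`. -/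
theorem timeNet_convergence (T θ : ℝ) (hT : 0 < T) (hθ : θ ∈ Set.Ioc (0:ℝ) 1) :
    (∀ b ∈ Set.Ioo (0:ℝ) T, ∀ r ∈ Set.Ico (0:ℝ) 1, ∀ n : ℕ, 1 ≤ n →
      ∀ u ∈ Set.Ioc (0:ℝ) b,
        2 * θ * (n : ℝ) / T * (min (upKnot (randNet T θ r n) (n + 1) u) b - u) ≤ 2) ∧
    (∀ b ∈ Set.Ioo (0:ℝ) T, ∀ u ∈ Set.Ioo (0:ℝ) b,
      Filter.Tendsto
        (fun n : ℕ => 2 * θ * (n : ℝ) / T *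
          ∫ r in (0:ℝ)..1, (min (upKnot (randNet T θ r n) (n + 1) u) b - u))
        Filter.atTop (nhds (((T - u) / T) ^ (1 - θ)))) ∧
    (∀ b ∈ Set.Ioo (0:ℝ) T, ∀ D : ℝ → ℝ, IntegrableOn D (Set.Icc 0 b) →
      Filter.Tendsto
        (fun n : ℕ => 2 * θ * (n : ℝ) / T *
          ∫ u in (0:ℝ)..b, (min (upKnot (detNet T θ n) n u) b - u) * D u)
        Filter.atTop (nhds (∫ u in (0:ℝ)..b, ((T - u) / T) ^ (1 - θ) * D u))) := by
  exact ⟨part1 hT hθ, part2 hT hθ, part3 hT hθ⟩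
end

section
/- Let T>0, let (Ω,F,P,(F_t)_{t∈[0,T]}) be a complete filtered probability space satisfying the usual conditions, let Π,Υ:Ω×B((0,T))→[0,∞] be random measures (kernels), let (φ_t)_{t∈[0,T)} be progressively measurable, and let κ≥1. Assume Π(ω,(0,b]) + Υ(ω,(0,b]) + sup_{t∈[0,b]}|φ_t(ω)| < ∞ for all (ω,b)∈Ω×(0,T), and that for all 0≤s≤a<b<T one has, almost surely, E[∫_{(a,b]} |φ_u − φ_s|² Π(·,du) | F_a] ≤ κ E[ |φ_a − φ_s|² Π(·,(a,b]) + ∫_{(a,b]} (b−u) Υ(·,du) | F_a]. Then for every (θ,a)∈(0,1]×[0,T) and every τ∈𝒯, with a̱:=a̱(τ) and ā:=ā(τ), one has almost surely E[[φ;τ]^Π_T − [φ;τ]^Π_a | F_a] / ‖τ‖_θ ≤ κ E[ ∫_{(a,T)} (T−u)^{1−θ} Υ(·,du) + ((T−a̱)^{1−θ}/(ā−a̱)) |φ_a − φ_{a̱}|² Π(·,(a,ā]) | F_a]; moreover, if a∈τ, then E[[φ;τ]^Π_T − [φ;τ]^Π_a | F_a] / ‖τ‖_θ ≤ κ E[ ∫_{(a,T)}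 (T−u)^{1−θ} Υ(·,du) | F_a] almost surely. -/
open MeasureTheory Filter Set ENNReal ProbabilityTheory

/-- A deterministic time net `0 = t_0 < t_1 < ⋯ < t_n = T` with `n ≥ 1`. -/
def IsTimeNet (T : ℝ) (n : ℕ) (t : ℕ → ℝ) : Prop :=
  1 ≤ n ∧ t 0 = 0 ∧ t n = T ∧ ∀ i < n, t i < t (i + 1)

/-- The mesh size `‖τ‖_θ = max_{1≤i≤n} (t_i − t_{i−1})/(T − t_{i−1})^{1−θ}`. -/
noncomputable def meshTheta (T θ : ℝ) (n : ℕ) (t : ℕ → ℝ) : ℝ :=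
  ⨆ i ∈ Finset.range n, (t (i + 1) - t i) / (T - t i) ^ (1 - θ)

/-- The simple predictable step function `u ↦ Σ_{i=1}^n φ_{t_{i−1}} 1_{(t_{i−1},t_i]}(u)`. -/
noncomputable def stepFn {Ω : Type*} (φ : ℝ → Ω → ℝ) (n : ℕ) (t : ℕ → ℝ)
    (u : ℝ) (ω : Ω) : ℝ :=
  ∑ i ∈ Finset.range n, if u ∈ Set.Ioc (t i) (t (i + 1)) then φ (t i) ω else 0


lemma rmub_sfinite {Ω : Type*} {mΩ : MeasurableSpace Ω} (K : Kernel Ω ℝ)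
    (h : ∀ ω, K ω Set.univ < ⊤) : IsSFiniteKernel K := by
  classical
  have hm : Measurable (fun ω => K ω Set.univ) := K.measurable_coe MeasurableSet.univ
  let f : Ω → ℕ := fun ω => ⌊(K ω Set.univ).toReal⌋₊
  have hf : Measurable f := Nat.measurable_floor.comp hm.ennreal_toReal
  have hS : ∀ n : ℕ, MeasurableSet (f ⁻¹' {n}) := fun n => hf (measurableSet_singleton n)
  refine ⟨⟨fun n => Kernel.piecewise (hS n) K 0, fun n => ⟨⟨ENNReal.ofReal (n + 1),
    ENNReal.ofReal_lt_top, fun ω => ?_⟩⟩, ?_⟩⟩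
  · rw [Kernel.piecewise_apply']
    split_ifs with hω
    · have h1 : f ω = n := hω
      have h2 := Nat.lt_floor_add_one ((K ω Set.univ).toReal)
      rw [← ENNReal.ofReal_toReal (h ω).ne]
      apply ENNReal.ofReal_le_ofReal
      rw [← h1]
      exact h2.le
    · simp
  · ext ω s hs
    rw [Kernel.sum_apply' _ _ hs, tsum_eq_single (f ω)]
    · rw [Kernel.piecewise_apply', if_pos (by simp)]
    · intro n hn
      rw [Kernel.piecewise_apply', if_neg (by simpa using fun h => hn h.symm)]
      simp

lemma rmub_meas {Ω : Type*} {mΩ : MeasurableSpace Ω}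
    (ℱ : Filtration ℝ mΩ) (T : ℝ)
    (Pm : Kernel Ω ℝ) (φ : ℝ → Ω → ℝ) (hφ : IsStronglyProgressive ℱ φ)
    (hfin : ∀ ω : Ω, ∀ b ∈ Set.Ioo (0:ℝ) T, Pm ω (Set.Ioc 0 b) < ⊤)
    (s a b : ℝ) (hs : 0 ≤ s) (hsa : s ≤ a) (hab : a < b) (hb : b < T) :
    Measurable (fun ω =>
      ∫⁻ u in Set.Ioc a b, ENNReal.ofReal ((φ u ω - φ s ω) ^ 2) ∂(Pm ω)) := by
  have h1 : Measurable (fun p : Set.Iic b × Ω => φ p.1 p.2) := by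
    have h2 := (hφ b).measurable
    refine h2.mono ?_ le_rfl
    exact sup_le_sup le_rfl (MeasurableSpace.comap_mono (ℱ.le b))
  have h3 : Measurable (fun p : Ω × ℝ => φ (min p.2 b) p.1) :=
    h1.comp (g := fun p : Set.Iic b × Ω => φ p.1 p.2)
      (f := fun p : Ω × ℝ => ((⟨min p.2 b, Set.mem_Iic.2 (min_le_right _ _)⟩ : Set.Iic b), p.1)) (by
        refine Measurable.prodMk ?_ measurable_fst
        exact Measurable.subtype_mk (measurable_snd.min measurable_const))
  have h4 : Measurable (fun p : Ω × ℝ => φ s p.1) := by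
    have := h3.comp (g := fun p : Ω × ℝ => φ (min p.2 b) p.1)
      (f := fun p : Ω × ℝ => (p.1, s)) (by fun_prop)
    have hsb : min s b = s := min_eq_left (by linarith)
    simpa [Function.comp_def, hsb] using this
  haveI : IsSFiniteKernel (Pm.restrict (measurableSet_Ioc (a := a) (b := b))) := by
    apply rmub_sfinite
    intro ω
    rw [Kernel.restrict_apply, Measure.restrict_apply_univ]
    exact lt_of_le_of_lt (measure_mono (Set.Ioc_subset_Ioc_left (by linarith)))
      (hfin ω b ⟨by linarith, hb⟩)
  have h5 : Measurable (fun ω => ∫⁻ u, ENNReal.ofReal ((φ (min u b) ω - φ s ω) ^ 2)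
      ∂(Pm.restrict (measurableSet_Ioc (a := a) (b := b)) ω)) := by
    apply Measurable.lintegral_kernel_prod_right
    exact ENNReal.measurable_ofReal.comp ((h3.sub h4).pow_const 2)
  convert h5 using 2 with ω
  rw [Kernel.restrict_apply]
  apply setLIntegral_congr_fun measurableSet_Ioc
  intro u hu
  simp only [min_eq_left hu.2]

lemma rmub_quasi {Ω : Type*} {mΩ : MeasurableSpace Ω} {μ : Measure Ω}
    (ℱ : Filtration ℝ mΩ) (T : ℝ)
    (Pm Um : Kernel Ω ℝ) (φ : ℝ → Ω → ℝ) (hφ : IsStronglyProgressive ℱ φ) (κ : ℝ)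
    (hfin : ∀ ω : Ω, ∀ b ∈ Set.Ioo (0:ℝ) T, Pm ω (Set.Ioc 0 b) < ⊤)
    (hquasi : ∀ s a b : ℝ, 0 ≤ s → s ≤ a → a < b → b < T →
      ∀ A : Set Ω, MeasurableSet[ℱ a] A →
        (∫⁻ ω in A,
          ∫⁻ u in Set.Ioc a b, ENNReal.ofReal ((φ u ω - φ s ω) ^ 2) ∂(Pm ω) ∂μ)
          ≤ ENNReal.ofReal κ * ∫⁻ ω in A,
              (ENNReal.ofReal ((φ a ω - φ s ω) ^ 2) * Pm ω (Set.Ioc a b)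
                + ∫⁻ u in Set.Ioc a b, ENNReal.ofReal (b - u) ∂(Um ω)) ∂μ)
    (s a b : ℝ) (hs : 0 ≤ s) (hsa : s ≤ a) (hab : a < b) (hb : b ≤ T) :
    Measurable (fun ω =>
      ∫⁻ u in Set.Ioc a b ∩ Set.Iio T, ENNReal.ofReal ((φ u ω - φ s ω) ^ 2) ∂(Pm ω)) ∧
    ∀ A : Set Ω, MeasurableSet[ℱ a] A →
        (∫⁻ ω in A,
          ∫⁻ u in Set.Ioc a b ∩ Set.Iio T, ENNReal.ofReal ((φ u ω - φ s ω) ^ 2) ∂(Pm ω) ∂μ)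
          ≤ ENNReal.ofReal κ * ∫⁻ ω in A,
              (ENNReal.ofReal ((φ a ω - φ s ω) ^ 2) * Pm ω (Set.Ioc a b)
                + ∫⁻ u in Set.Ioc a b ∩ Set.Iio T, ENNReal.ofReal (b - u) ∂(Um ω)) ∂μ := by
  rcases hb.lt_or_eq with hb | rfl
  · have : Set.Ioc a b ∩ Set.Iio T = Set.Ioc a b := by
      rw [Set.inter_eq_left]; exact fun x hx => lt_of_le_of_lt hx.2 hb
    rw [this]
    exact ⟨rmub_meas ℱ T Pm φ hφ hfin s a b hs hsa hab hb, hquasi s a b hs hsa hab hb⟩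
  · obtain ⟨v, hv, hvm, hvl⟩ := exists_seq_strictMono_tendsto' hab
    have hU : Set.Ioc a b ∩ Set.Iio b = ⋃ m, Set.Ioc a (v m) := by
      ext x
      simp only [Set.mem_inter_iff, Set.mem_Ioc, Set.mem_Iio, Set.mem_iUnion]
      constructor
      · rintro ⟨⟨h1, h2⟩, h3⟩
        obtain ⟨m, hm⟩ := (hvl.eventually (lt_mem_nhds h3)).exists
        exact ⟨m, h1, hm.le⟩
      · rintro ⟨m, h1, h2⟩
        have := (hvm m).2
        exact ⟨⟨h1, by linarith⟩, by linarith⟩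
    have hmono : Monotone (fun m => Set.Ioc a (v m)) := fun i j hij =>
      Set.Ioc_subset_Ioc_right (hv.monotone hij)
    have heq : ∀ ω, ∫⁻ u in Set.Ioc a b ∩ Set.Iio b,
        ENNReal.ofReal ((φ u ω - φ s ω) ^ 2) ∂(Pm ω) =
        ⨆ m, ∫⁻ u in Set.Ioc a (v m), ENNReal.ofReal ((φ u ω - φ s ω) ^ 2) ∂(Pm ω) := by
      intro ω
      rw [hU, setLIntegral_iUnion_of_directed _ hmono.directed_le]
    have hms : ∀ m, Measurable (fun ω =>
        ∫⁻ u in Set.Ioc a (v m), ENNReal.ofReal ((φ u ω - φ s ω) ^ 2) ∂(Pm ω)) :=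
      fun m => rmub_meas ℱ b Pm φ hφ hfin s a (v m) hs hsa (hvm m).1 (hvm m).2
    simp_rw [heq]
    refine ⟨Measurable.iSup hms, fun A hA => ?_⟩
    rw [lintegral_iSup hms (fun i j hij ω => lintegral_mono_set (hmono hij))]
    refine iSup_le fun m => (hquasi s a (v m) hs hsa (hvm m).1 (hvm m).2 A hA).trans ?_
    gcongr with ω
    · exact (hvm m).2.le
    · rw [hU]; exact Set.subset_iUnion (fun m => Set.Ioc a (v m)) m
    · exact (hvm m).2.le

lemma rmub_real (T θ s b u M : ℝ) (hθ : θ ∈ Set.Ioc (0:ℝ) 1) (hsb : s < b) (hb : b ≤ T)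
    (hsu : s ≤ u) (huT : u < T)
    (hM : (b - s) / (T - s) ^ (1 - θ) ≤ M) : b - u ≤ M * (T - u) ^ (1 - θ) := by
  have h1 : 0 < T - s := by linarith
  have h2 : 0 < T - u := by linarith
  have h0 : 0 < (T - s) ^ (1 - θ) := Real.rpow_pos_of_pos h1 _
  have h3 : (T - u) / (T - s) ≤ ((T - u) / (T - s)) ^ (1 - θ) := by
    apply Real.self_le_rpow_of_le_one (by positivity)
    · rw [div_le_one h1]; linarith
    · linarith [hθ.1]
  rw [Real.div_rpow h2.le h1.le] at h3
  have h4 : b - u ≤ (b - s) * ((T - u) / (T - s)) := by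
    rw [← mul_div_assoc, le_div_iff₀ h1]
    nlinarith
  calc b - u ≤ (b - s) * ((T - u) / (T - s)) := h4
    _ ≤ (b - s) * ((T - u) ^ (1 - θ) / (T - s) ^ (1 - θ)) :=
        mul_le_mul_of_nonneg_left h3 (by linarith)
    _ = (b - s) / (T - s) ^ (1 - θ) * (T - u) ^ (1 - θ) := by ring
    _ ≤ M * (T - u) ^ (1 - θ) := by gcongr

lemma rmub_mesh (T θ : ℝ) (n : ℕ) (t : ℕ → ℝ) (k : ℕ) (hk : k < n) :
    (t (k + 1) - t k) / (T - t k) ^ (1 - θ) ≤ meshTheta T θ n t := by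
  unfold meshTheta
  set f : ℕ → ℝ := fun i => (t (i + 1) - t i) / (T - t i) ^ (1 - θ) with hf
  have hbdd : BddAbove (Set.range fun i => ⨆ (_ : i ∈ Finset.range n), f i) := by
    refine ⟨∑ i ∈ Finset.range n, |f i|, ?_⟩
    rintro _ ⟨i, rfl⟩
    by_cases hi : i ∈ Finset.range n
    · simp only [hi, ciSup_unique]
      exact (le_abs_self _).trans
        (Finset.single_le_sum (f := fun i => |f i|) (fun _ _ => abs_nonneg _) hi)
    · simp only [hi, Real.iSup_of_isEmpty]
      exact Finset.sum_nonneg fun _ _ => abs_nonneg _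
  refine le_trans ?_ (le_ciSup hbdd k)
  have : k ∈ Finset.range n := Finset.mem_range.2 hk
  simp [this, hf]

lemma rmub_net {T : ℝ} {n : ℕ} {t : ℕ → ℝ} (h : IsTimeNet T n t) {i j : ℕ}
    (hij : i ≤ j) (hj : j ≤ n) : t i ≤ t j := by
  induction j, hij using Nat.le_induction with
  | base => exact le_rfl
  | succ m hm ih => exact (ih (by omega)).trans (h.2.2.2 m (by omega)).le

lemma rmub_step {Ω : Type*} {T : ℝ} {n : ℕ} {t : ℕ → ℝ} (h : IsTimeNet T n t)
    (φ : ℝ → Ω → ℝ) {k : ℕ} (hk : k < n) {u : ℝ} (hu : u ∈ Set.Ioc (t k) (t (k + 1))) (ω : Ω) :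
    stepFn φ n t u ω = φ (t k) ω := by
  unfold stepFn
  rw [Finset.sum_eq_single k]
  · rw [if_pos hu]
  · intro i hi hik
    rw [Finset.mem_range] at hi
    rw [if_neg]
    rintro ⟨h1, h2⟩
    rcases lt_or_gt_of_ne hik with hlt | hlt
    · have := rmub_net h (i := i + 1) (j := k) hlt hk.le
      linarith [hu.1]
    · have := rmub_net h (i := k + 1) (j := i) hlt hi.le
      linarith [hu.2]
  · intro hh; exact absurd (Finset.mem_range.2 hk) hh

/-- Upper bound for the square function of the Riemann approximation with respect to random
measures `Π` (here `Pm`) and `Υ` (here `Um`), under the quasi-orthogonality assumption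
`(≤)`-version of the paper.  The conditional inequalities are expressed in the extended
sense via `lintegral`s over `F_a`-measurable sets.  The quantity
`[φ;τ]^Π_T − [φ;τ]^Π_a = ∫_{(a,T)} |φ_u − step_τ(u)|² Π(·,du)` and the mesh `‖τ‖_θ`
multiplies the right-hand side. -/
theorem randomMeasure_upper_bound
    {Ω : Type*} {mΩ : MeasurableSpace Ω} {μ : Measure Ω} [IsProbabilityMeasure μ]
    (ℱ : Filtration ℝ mΩ) (T : ℝ) (hT : 0 < T)
    (hComplete : ∀ s : ℝ, ∀ A : Set Ω, μ A = 0 → MeasurableSet[ℱ s] A)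
    (hRight : ∀ s : ℝ, (ℱ s : MeasurableSpace Ω) = ⨅ u ∈ Set.Ioi s, (ℱ u : MeasurableSpace Ω))
    (Pm Um : Kernel Ω ℝ)
    (φ : ℝ → Ω → ℝ) (hφ : ProgMeasurable ℱ φ)
    (κ : ℝ) (hκ : 1 ≤ κ)
    (hfin : ∀ ω : Ω, ∀ b ∈ Set.Ioo (0:ℝ) T,
      Pm ω (Set.Ioc 0 b) < ⊤ ∧ Um ω (Set.Ioc 0 b) < ⊤ ∧
        ∃ C : ℝ, ∀ u ∈ Set.Icc (0:ℝ) b, |φ u ω| ≤ C)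
    (hquasi : ∀ s a b : ℝ, 0 ≤ s → s ≤ a → a < b → b < T →
      ∀ A : Set Ω, MeasurableSet[ℱ a] A →
        (∫⁻ ω in A,
          ∫⁻ u in Set.Ioc a b, ENNReal.ofReal ((φ u ω - φ s ω) ^ 2) ∂(Pm ω) ∂μ)
          ≤ ENNReal.ofReal κ * ∫⁻ ω in A,
              (ENNReal.ofReal ((φ a ω - φ s ω) ^ 2) * Pm ω (Set.Ioc a b)
                + ∫⁻ u in Set.Ioc a b, ENNReal.ofReal (b - u) ∂(Um ω)) ∂μ) :
    ∀ θ ∈ Set.Ioc (0:ℝ) 1, ∀ a ∈ Set.Ico (0:ℝ) T,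
    ∀ (n : ℕ) (t : ℕ → ℝ), IsTimeNet T n t →
    ∀ k < n, a ∈ Set.Ico (t k) (t (k + 1)) →
    ∀ A : Set Ω, MeasurableSet[ℱ a] A →
      ((∫⁻ ω in A,
          ∫⁻ u in Set.Ioo a T, ENNReal.ofReal ((φ u ω - stepFn φ n t u ω) ^ 2) ∂(Pm ω) ∂μ)
        ≤ ENNReal.ofReal (κ * meshTheta T θ n t) *
          ∫⁻ ω in A,
            ((∫⁻ u in Set.Ioo a T, ENNReal.ofReal ((T - u) ^ (1 - θ)) ∂(Um ω))
              + ENNReal.ofReal ((T - t k) ^ (1 - θ) / (t (k + 1) - t k)) *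
                ENNReal.ofReal ((φ a ω - φ (t k) ω) ^ 2) *
                Pm ω (Set.Ioc a (t (k + 1)))) ∂μ) ∧
      (a = t k →
        (∫⁻ ω in A,
          ∫⁻ u in Set.Ioo a T, ENNReal.ofReal ((φ u ω - stepFn φ n t u ω) ^ 2) ∂(Pm ω) ∂μ)
          ≤ ENNReal.ofReal (κ * meshTheta T θ n t) *
            ∫⁻ ω in A,
              (∫⁻ u in Set.Ioo a T, ENNReal.ofReal ((T - u) ^ (1 - θ)) ∂(Um ω)) ∂μ) := by
  have hfin' : ∀ ω : Ω, ∀ b ∈ Set.Ioo (0:ℝ) T, Pm ω (Set.Ioc 0 b) < ⊤ :=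
    fun ω b hb => (hfin ω b hb).1
  have hφ' : IsStronglyProgressive ℱ φ := hφ
  intro θ hθ a₀ ha₀ n t hnet
  set M := meshTheta T θ n t with hMdef
  -- one step of the backward induction
  have key : ∀ k < n,
      (∀ A : Set Ω, MeasurableSet[ℱ (t (k + 1))] A →
        (∫⁻ ω in A, ∫⁻ u in Set.Ioo (t (k + 1)) T,
          ENNReal.ofReal ((φ u ω - stepFn φ n t u ω) ^ 2) ∂(Pm ω) ∂μ)
          ≤ ENNReal.ofReal (κ * M) * ∫⁻ ω in A,
            (∫⁻ u in Set.Ioo (t (k + 1)) T, ENNReal.ofReal ((T - u) ^ (1 - θ)) ∂(Um ω)) ∂μ) →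
      ∀ a ∈ Set.Ico (t k) (t (k + 1)), ∀ A : Set Ω, MeasurableSet[ℱ a] A →
      (∫⁻ ω in A,
          ∫⁻ u in Set.Ioo a T, ENNReal.ofReal ((φ u ω - stepFn φ n t u ω) ^ 2) ∂(Pm ω) ∂μ)
        ≤ ENNReal.ofReal (κ * M) *
          ∫⁻ ω in A,
            ((∫⁻ u in Set.Ioo a T, ENNReal.ofReal ((T - u) ^ (1 - θ)) ∂(Um ω))
              + ENNReal.ofReal ((T - t k) ^ (1 - θ) / (t (k + 1) - t k)) *
                ENNReal.ofReal ((φ a ω - φ (t k) ω) ^ 2) *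
                Pm ω (Set.Ioc a (t (k + 1)))) ∂μ := by
    intro k hk IH a ha A hA
    have hlt := hnet.2.2.2 k hk
    have hbT : t (k + 1) ≤ T := by
      have := rmub_net hnet (i := k + 1) (j := n) hk le_rfl
      rwa [hnet.2.2.1] at this
    have h0 : 0 ≤ t k := by
      have := rmub_net hnet (i := 0) (j := k) (Nat.zero_le _) hk.le
      rwa [hnet.2.1] at this
    have hmesh := rmub_mesh T θ n t k hk
    rw [← hMdef] at hmesh
    have hpow : 0 < (T - t k) ^ (1 - θ) := Real.rpow_pos_of_pos (by linarith) _
    have hM0 : 0 < M := lt_of_lt_of_le (div_pos (by linarith) hpow) hmesh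
    have hκ0 : 0 ≤ κ := by linarith
    obtain ⟨hmeas, hq⟩ := rmub_quasi ℱ T Pm Um φ hφ' κ hfin' hquasi (t k) a (t (k + 1))
      h0 ha.1 ha.2 hbT
    have hsplit : Set.Ioo a T =
        (Set.Ioc a (t (k + 1)) ∩ Set.Iio T) ∪ Set.Ioo (t (k + 1)) T := by
      ext x
      simp only [Set.mem_Ioo, Set.mem_union, Set.mem_inter_iff, Set.mem_Ioc, Set.mem_Iio]
      constructor
      · rintro ⟨h1, h2⟩
        rcases le_or_gt x (t (k + 1)) with h | h
        · exact Or.inl ⟨⟨h1, h⟩, h2⟩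
        · exact Or.inr ⟨h, h2⟩
      · rintro (⟨⟨h1, _⟩, h2⟩ | ⟨h1, h2⟩)
        · exact ⟨h1, h2⟩
        · exact ⟨ha.2.trans h1, h2⟩
    have hdisj : Disjoint (Set.Ioc a (t (k + 1)) ∩ Set.Iio T) (Set.Ioo (t (k + 1)) T) := by
      rw [Set.disjoint_left]
      rintro x ⟨⟨_, h1⟩, _⟩ ⟨h2, _⟩
      linarith
    have hJ : MeasurableSet (Set.Ioc a (t (k + 1)) ∩ Set.Iio T) :=
      measurableSet_Ioc.inter measurableSet_Iio
    have hA' : MeasurableSet[ℱ (t (k + 1))] A := ℱ.mono ha.2.le A hA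
    have hL : ∀ ω, ∫⁻ u in Set.Ioo a T,
          ENNReal.ofReal ((φ u ω - stepFn φ n t u ω) ^ 2) ∂(Pm ω) =
        (∫⁻ u in Set.Ioc a (t (k + 1)) ∩ Set.Iio T,
          ENNReal.ofReal ((φ u ω - φ (t k) ω) ^ 2) ∂(Pm ω)) +
        ∫⁻ u in Set.Ioo (t (k + 1)) T,
          ENNReal.ofReal ((φ u ω - stepFn φ n t u ω) ^ 2) ∂(Pm ω) := by
      intro ω
      rw [hsplit, lintegral_union measurableSet_Ioo hdisj]
      congr 1
      apply setLIntegral_congr_fun hJ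
      intro u hu
      simp only
      rw [rmub_step hnet φ hk ⟨lt_of_le_of_lt ha.1 hu.1.1, hu.1.2⟩]
    have hR : ∀ ω, ∫⁻ u in Set.Ioo a T, ENNReal.ofReal ((T - u) ^ (1 - θ)) ∂(Um ω) =
        (∫⁻ u in Set.Ioc a (t (k + 1)) ∩ Set.Iio T,
          ENNReal.ofReal ((T - u) ^ (1 - θ)) ∂(Um ω)) +
        ∫⁻ u in Set.Ioo (t (k + 1)) T, ENNReal.ofReal ((T - u) ^ (1 - θ)) ∂(Um ω) := by
      intro ω
      rw [hsplit, lintegral_union measurableSet_Ioo hdisj]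
    have hU : ∀ ω, ∫⁻ u in Set.Ioc a (t (k + 1)) ∩ Set.Iio T,
          ENNReal.ofReal (t (k + 1) - u) ∂(Um ω) ≤
        ENNReal.ofReal M * ∫⁻ u in Set.Ioc a (t (k + 1)) ∩ Set.Iio T,
          ENNReal.ofReal ((T - u) ^ (1 - θ)) ∂(Um ω) := by
      intro ω
      rw [← lintegral_const_mul' _ _ ENNReal.ofReal_ne_top]
      apply setLIntegral_mono' hJ
      intro u hu
      rw [← ENNReal.ofReal_mul hM0.le]
      exact ENNReal.ofReal_le_ofReal (rmub_real T θ (t k) (t (k + 1)) u M hθ hlt hbT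
        (ha.1.trans hu.1.1.le) hu.2 hmesh)
    have hone : 1 ≤ ENNReal.ofReal M *
        ENNReal.ofReal ((T - t k) ^ (1 - θ) / (t (k + 1) - t k)) := by
      rw [← ENNReal.ofReal_mul hM0.le, ENNReal.one_le_ofReal]
      have hd : 0 < t (k + 1) - t k := by linarith
      rw [← mul_div_assoc, le_div_iff₀ hd, one_mul]
      rwa [div_le_iff₀ hpow] at hmesh
    simp_rw [hL]
    rw [lintegral_add_left hmeas]
    refine (add_le_add (hq A hA) (IH A hA')).trans ?_
    have hmid : ENNReal.ofReal κ * ∫⁻ ω in A,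
              (ENNReal.ofReal ((φ a ω - φ (t k) ω) ^ 2) * Pm ω (Set.Ioc a (t (k + 1)))
                + ∫⁻ u in Set.Ioc a (t (k + 1)) ∩ Set.Iio T,
                    ENNReal.ofReal (t (k + 1) - u) ∂(Um ω)) ∂μ
        ≤ ENNReal.ofReal (κ * M) * ∫⁻ ω in A,
          ((∫⁻ u in Set.Ioc a (t (k + 1)) ∩ Set.Iio T,
            ENNReal.ofReal ((T - u) ^ (1 - θ)) ∂(Um ω))
            + ENNReal.ofReal ((T - t k) ^ (1 - θ) / (t (k + 1) - t k)) *
                ENNReal.ofReal ((φ a ω - φ (t k) ω) ^ 2) *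
                Pm ω (Set.Ioc a (t (k + 1)))) ∂μ := by
      rw [ENNReal.ofReal_mul hκ0, mul_assoc]
      gcongr
      rw [← lintegral_const_mul' _ _ ENNReal.ofReal_ne_top]
      apply lintegral_mono
      intro ω
      simp only
      rw [mul_add, add_comm]
      refine add_le_add (hU ω) ?_
      rw [← mul_assoc, ← mul_assoc]
      gcongr
      exact le_mul_of_one_le_left (zero_le) hone
    refine (add_le_add hmid le_rfl).trans ?_
    rw [← mul_add]
    gcongr
    refine (le_lintegral_add _ _).trans (lintegral_mono fun ω => ?_)
    simp only
    rw [hR ω, add_right_comm]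
  have zero : ∀ k, ∀ a, a = t k → ∀ A : Set Ω, 
      ∫⁻ ω in A,
            ((∫⁻ u in Set.Ioo a T, ENNReal.ofReal ((T - u) ^ (1 - θ)) ∂(Um ω))
              + ENNReal.ofReal ((T - t k) ^ (1 - θ) / (t (k + 1) - t k)) *
                ENNReal.ofReal ((φ a ω - φ (t k) ω) ^ 2) *
                Pm ω (Set.Ioc a (t (k + 1)))) ∂μ =
      ∫⁻ ω in A, (∫⁻ u in Set.Ioo a T, ENNReal.ofReal ((T - u) ^ (1 - θ)) ∂(Um ω)) ∂μ := by
    intro k a hak A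
    subst hak
    simp
  have P : ∀ m ≤ n, ∀ A : Set Ω, MeasurableSet[ℱ (t (n - m))] A →
        (∫⁻ ω in A, ∫⁻ u in Set.Ioo (t (n - m)) T,
          ENNReal.ofReal ((φ u ω - stepFn φ n t u ω) ^ 2) ∂(Pm ω) ∂μ)
          ≤ ENNReal.ofReal (κ * M) * ∫⁻ ω in A,
            (∫⁻ u in Set.Ioo (t (n - m)) T, ENNReal.ofReal ((T - u) ^ (1 - θ)) ∂(Um ω)) ∂μ := by
    intro m
    induction m with
    | zero =>
      intro _ A _
      simp [hnet.2.2.1]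
    | succ m ih =>
      intro hm A hA
      have hk : n - (m + 1) < n := by omega
      have he : n - (m + 1) + 1 = n - m := by omega
      have := key (n - (m + 1)) hk (by rw [he]; exact ih (by omega)) (t (n - (m + 1)))
        ⟨le_rfl, hnet.2.2.2 _ hk⟩ A hA
      rwa [zero _ _ rfl] at this
  intro k hk hak A hA
  have main := key k hk (by
    have := P (n - (k + 1)) (by omega)
    rwa [show n - (n - (k + 1)) = k + 1 by omega] at this) a₀ hak A hA
  refine ⟨main, fun h => ?_⟩
  rwa [zero k a₀ h] at main
end

section
/- Let T>0 and let φ=(φ_t)_{t∈[0,T)} be a stochastic process on a probability space with values in ℝ. Then: (1) for every t∈(0,T) one has Osc̲_t(φ) ≤ Osc̄_t(φ); (2) if in addition φ is a martingale with respect to a filtration (F_t)_{t∈[0,T)}, then Osc̄_t(φ) ≤ 2·Osc̲_t(φ) for every t∈(0,T). -/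
open MeasureTheory Filter Set ENNReal

/-- `Osc̲_t(φ) := inf_{s∈[0,t)} ‖φ_t − φ_s‖_{L_∞}` (in `ℝ≥0∞`). -/
noncomputable def oscLow {Ω : Type*} [MeasurableSpace Ω] (μ : Measure Ω)
    (φ : ℝ → Ω → ℝ) (t : ℝ) : ℝ≥0∞ :=
  ⨅ s ∈ Set.Ico (0:ℝ) t, eLpNorm (fun ω => φ t ω - φ s ω) ⊤ μ

/-- `Osc̄_t(φ) := inf_{s∈[0,t)} sup_{u∈[s,t]} ‖φ_t − φ_u‖_{L_∞}` (in `ℝ≥0∞`). -/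
noncomputable def oscUp {Ω : Type*} [MeasurableSpace Ω] (μ : Measure Ω)
    (φ : ℝ → Ω → ℝ) (t : ℝ) : ℝ≥0∞ :=
  ⨅ s ∈ Set.Ico (0:ℝ) t, ⨆ u ∈ Set.Icc s t, eLpNorm (fun ω => φ t ω - φ u ω) ⊤ μ

/-- (1) `Osc̲_t(φ) ≤ Osc̄_t(φ)` for any process `φ`;
(2) if `φ` is a martingale (with respect to some filtration), then
`Osc̄_t(φ) ≤ 2 Osc̲_t(φ)`. -/
theorem osc_relations
    {Ω : Type*} {mΩ : MeasurableSpace Ω} {μ : Measure Ω} [IsProbabilityMeasure μ]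
    (T : ℝ) (hT : 0 < T) (φ : ℝ → Ω → ℝ) :
    (∀ t ∈ Set.Ioo (0:ℝ) T, oscLow μ φ t ≤ oscUp μ φ t) ∧
    (∀ ℱ : Filtration ℝ mΩ,
      (∀ t ∈ Set.Ico (0:ℝ) T, StronglyMeasurable[ℱ t] (φ t)) →
      (∀ t ∈ Set.Ico (0:ℝ) T, Integrable (φ t) μ) →
      (∀ s t : ℝ, s ∈ Set.Ico (0:ℝ) T → t ∈ Set.Ico (0:ℝ) T → s ≤ t →
        μ[φ t | ℱ s] =ᵐ[μ] φ s) →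
      ∀ t ∈ Set.Ioo (0:ℝ) T, oscUp μ φ t ≤ 2 * oscLow μ φ t) := by
  refine ⟨fun t ht => ?_, fun ℱ hm hi hc t ht => ?_⟩
  · refine le_iInf₂ fun s hs => ?_
    refine (iInf₂_le s hs).trans ?_
    exact le_iSup₂ (f := fun u (_ : u ∈ Set.Icc s t) =>
      eLpNorm (fun ω => φ t ω - φ u ω) ⊤ μ) s ⟨le_rfl, hs.2.le⟩
  · have htT : t ∈ Set.Ico (0:ℝ) T := ⟨ht.1.le, ht.2⟩
    unfold oscLow
    simp_rw [ENNReal.mul_iInf_of_ne (two_ne_zero) (ENNReal.ofNat_ne_top)]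
    refine le_iInf₂ fun s hs => ?_
    refine (iInf₂_le s hs).trans ?_
    refine iSup₂_le fun u hu => ?_
    have hsT : s ∈ Set.Ico (0:ℝ) T := ⟨hs.1, hs.2.trans ht.2⟩
    have huT : u ∈ Set.Ico (0:ℝ) T := ⟨hs.1.trans hu.1, hu.2.trans_lt ht.2⟩
    have h1 : μ[φ t - φ s | ℱ u] =ᵐ[μ] φ u - φ s := by
      refine (condExp_sub (hi t htT) (hi s hsT) _).trans ?_
      rw [condExp_of_stronglyMeasurable (ℱ.le u) ((hm s hsT).mono (ℱ.mono hu.1)) (hi s hsT)]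
      exact (hc u t huT htT hu.2).sub (EventuallyEq.refl _ _)
    have h2 : (fun ω => φ t ω - φ u ω) =ᵐ[μ] (φ t - φ s) - μ[φ t - φ s | ℱ u] := by
      filter_upwards [h1] with ω h
      simp only [Pi.sub_apply] at h ⊢
      rw [h]; ring
    rw [eLpNorm_congr_ae h2]
    refine (eLpNorm_sub_le ((hi t htT).sub (hi s hsT)).aestronglyMeasurable
      integrable_condExp.aestronglyMeasurable le_top).trans ?_
    rw [two_mul]
    exact add_le_add le_rfl (eLpNorm_condExp_le_eLpNorm _ le_top)
end

section
/- Let (Ω,F,P) be a probability space, let A,B:Ω→ℝ be random variables, and let Q be a probability measure on (Ω,F) that is absolutely continuous with respect to P, such that E^Q|B|<∞ and E^Q B = 0. If ‖B − A‖_{L_∞(P)} ≥ inf_{a∈ℝ} ‖B − a‖_{L_∞(P)}, then ‖B − A‖_{L_∞(P)} ≥ (1/2)‖B‖_{L_∞(P)}. -/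
open MeasureTheory Filter Set ENNReal

/-- If `Q ≪ P`, `E^Q|B| < ∞`, `E^Q B = 0` and
`‖B − A‖_{L_∞(P)} ≥ inf_{a∈ℝ} ‖B − a‖_{L_∞(P)}`, then
`‖B − A‖_{L_∞(P)} ≥ (1/2)‖B‖_{L_∞(P)}` (formulated in `ℝ≥0∞`). -/
theorem osc_basic_lemma
    {Ω : Type*} {mΩ : MeasurableSpace Ω} (P Q : Measure Ω)
    [IsProbabilityMeasure P] [IsProbabilityMeasure Q]
    (A B : Ω → ℝ) (hQP : Q ≪ P)
    (hBint : Integrable B Q) (hBmean : (∫ ω, B ω ∂Q) = 0)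
    (hmin : (⨅ a : ℝ, eLpNorm (fun ω => B ω - a) ⊤ P)
      ≤ eLpNorm (fun ω => B ω - A ω) ⊤ P) :
    eLpNorm B ⊤ P ≤ 2 * eLpNorm (fun ω => B ω - A ω) ⊤ P := by
  have key : ∀ a : ℝ, eLpNorm B ⊤ P ≤ 2 * eLpNorm (fun ω => B ω - a) ⊤ P := by
    intro a
    by_cases hc : eLpNorm (fun ω => B ω - a) ⊤ P = ⊤
    · rw [hc]; simp
    have hP : ∀ᵐ ω ∂P, ‖B ω - a‖ ≤ (eLpNorm (fun ω => B ω - a) ⊤ P).toReal := by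
      have h := enorm_ae_le_eLpNormEssSup (fun ω => B ω - a) P
      rw [eLpNorm_exponent_top] at hc ⊢
      filter_upwards [h] with ω hω
      have := ENNReal.toReal_mono hc hω
      simpa using this
    set c := (eLpNorm (fun ω => B ω - a) ⊤ P).toReal with hcdef
    have hQ : ∀ᵐ ω ∂Q, ‖B ω - a‖ ≤ c := hQP.ae_le hP
    have ha : |a| ≤ c := by
      have h1 := norm_integral_le_of_norm_le_const hQ
      rw [integral_sub hBint (integrable_const a), hBmean] at h1
      simpa using h1
    have hB : ∀ᵐ ω ∂P, ‖B ω‖ ≤ 2 * c := by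
      filter_upwards [hP] with ω hω
      rw [Real.norm_eq_abs, abs_le] at hω ⊢
      rw [abs_le] at ha
      constructor <;> linarith [hω.1, hω.2, ha.1, ha.2]
    have h2 : eLpNorm B ⊤ P ≤ ENNReal.ofReal (2 * c) := by
      rw [eLpNorm_exponent_top]
      exact eLpNormEssSup_le_of_ae_bound hB
    refine h2.trans (le_of_eq ?_)
    rw [ENNReal.ofReal_mul (by norm_num), hcdef, ENNReal.ofReal_toReal hc]
    simp
  refine le_trans ?_ (mul_le_mul_right hmin 2)
  rw [ENNReal.mul_iInf_of_ne (by norm_num) (by norm_num)]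
  exact le_iInf key
end

section
/- Let T>0, let (Ω,F,P,(F_t)_{t∈[0,T]}) be a complete filtered probability space satisfying the usual conditions, let θ∈(0,1] and c>0, and let (φ_t)_{t∈[0,T)} be an adapted càdlàg process such that for all 0≤a<b<T and all F_a-measurable Z:Ω→ℝ one has (1/c)|φ_a − Z|² ≤ E[(1/(b−a))∫_a^b |φ_u − Z|² du | F_a] almost surely. If inf_{t∈(0,T)} (T−t)^{(1−θ)/2} Osc̲_t(φ) > 0, then there exists c'>0 such that for every time net τ={t_i}_{i=0}^n ∈ 𝒯 whose mesh is attained at the k-th interval, i.e. ‖τ‖_θ = (t_k−t_{k−1})/(T−t_{k−1})^{1−θ}, and for every choice of F_{t_{i−1}}-measurable random variables ϑ_{i−1}:Ω→ℝ (i=1,…,n), one has sup_{a∈[t_{k−1},t_k)} ‖ E[ ∫_a^T |φ_u − Σ_{i=1}^n ϑ_{i−1} 1_{(t_{i−1},t_i]}(u)|² du | F_a] ‖_{L_∞} ≥ (c')² ‖τ‖_θ. -/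
open MeasureTheory Filter Set ENNReal

/-- The step function `u ↦ Σ_{i=1}^n ϑ_{i−1} 1_{(t_{i−1},t_i]}(u)` built from the random
variables `ϑ i`. -/
noncomputable def stepOf {Ω : Type*} (ϑ : ℕ → Ω → ℝ) (n : ℕ) (t : ℕ → ℝ)
    (u : ℝ) (ω : Ω) : ℝ :=
  ∑ i ∈ Finset.range n, if u ∈ Set.Ioc (t i) (t (i + 1)) then ϑ i ω else 0



theorem ae_bound_aux {Ω : Type*} {mΩ : MeasurableSpace Ω} {μ : Measure Ω}
    [IsProbabilityMeasure μ] (g : Ω → ℝ) (hg : Measurable g) (K : ℝ)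
    (h : (∫⁻ ω in {ω | K < g ω}, ENNReal.ofReal (g ω) ∂μ)
      ≤ ENNReal.ofReal K * μ {ω | K < g ω}) (hK : 0 ≤ K) :
    ∀ᵐ ω ∂μ, g ω ≤ K := by
  have hm : MeasurableSet {ω | K < g ω} := measurableSet_lt measurable_const hg
  by_contra hcon
  have h0 : μ {ω | K < g ω} ≠ 0 := by
    intro h0
    apply hcon
    rw [ae_iff]
    simpa using h0
  have := setLIntegral_strict_mono (μ := μ) (f := fun _ => ENNReal.ofReal K)
    (g := fun ω => ENNReal.ofReal (g ω)) hm h0 hg.ennreal_ofReal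
    (by
      rw [setLIntegral_const]
      exact ENNReal.mul_ne_top ENNReal.ofReal_ne_top (measure_ne_top _ _))
    (Filter.Eventually.of_forall (fun ω hω =>
      (ENNReal.ofReal_lt_ofReal_iff (lt_of_le_of_lt hK hω)).2 hω))
  rw [setLIntegral_const] at this
  exact absurd h (not_le.2 this)

theorem net_mono_aux {T : ℝ} {n : ℕ} {t : ℕ → ℝ} (h : IsTimeNet T n t) :
    ∀ i j, i ≤ j → j ≤ n → t i ≤ t j := by
  intro i j hij
  induction j, hij using Nat.le_induction with
  | base => intro _; exact le_rfl
  | succ j hij ih =>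
    intro hj
    exact (ih (by omega)).trans (h.2.2.2 j (by omega)).le

theorem step_aux {Ω : Type*} {T : ℝ} {n : ℕ} {t : ℕ → ℝ} (h : IsTimeNet T n t)
    (ϑ : ℕ → Ω → ℝ) {k : ℕ} (hk : k < n) {u : ℝ} (hu : u ∈ Set.Ioc (t k) (t (k + 1))) (ω : Ω) :
    stepOf ϑ n t u ω = ϑ k ω := by
  unfold stepOf
  rw [Finset.sum_eq_single k]
  · rw [if_pos hu]
  · intro j hj hjk
    rw [Finset.mem_range] at hj
    rw [if_neg]
    intro hu'
    rcases lt_or_gt_of_ne hjk with hlt | hlt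
    · have := net_mono_aux h (j + 1) k hlt hk.le
      linarith [hu'.2, hu.1]
    · have := net_mono_aux h (k + 1) j hlt hj.le
      linarith [hu'.1, hu.2]
  · intro hk'
    exact absurd (Finset.mem_range.2 hk) hk'

/-- Lower bound for the approximation quantity: if the adapted càdlàg process `φ` satisfies
`(1/c)|φ_a − Z|² ≤ E[(1/(b−a))∫_a^b |φ_u − Z|² du | F_a]` a.s. (stated in the extended,
set-integral sense) and `inf_{t∈(0,T)} (T−t)^{(1−θ)/2} Osc̲_t(φ) > 0`, then there is a
`c' > 0` such that for every time net whose mesh `‖τ‖_θ` is attained at the `k`-th interval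
and every choice of `F_{t_{i−1}}`-measurable `ϑ_{i−1}` one has
`sup_{a∈[t_{k−1},t_k)} ‖E[∫_a^T |φ_u − Σ_i ϑ_{i−1}1_{(t_{i−1},t_i]}(u)|² du | F_a]‖_∞
  ≥ c'² ‖τ‖_θ` — expressed by saying that every uniform bound `M` of the conditional
expectations is at least `c'² ‖τ‖_θ`. -/
theorem osc_lower_bound_for_nets
    {Ω : Type*} {mΩ : MeasurableSpace Ω} {μ : Measure Ω} [IsProbabilityMeasure μ]
    (ℱ : Filtration ℝ mΩ) (T : ℝ) (hT : 0 < T)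
    (hComplete : ∀ s : ℝ, ∀ A : Set Ω, μ A = 0 → MeasurableSet[ℱ s] A)
    (hRight : ∀ s : ℝ, (ℱ s : MeasurableSpace Ω) = ⨅ u ∈ Set.Ioi s, (ℱ u : MeasurableSpace Ω))
    (θ : ℝ) (hθ : θ ∈ Set.Ioc (0:ℝ) 1) (c : ℝ) (hc : 0 < c)
    (φ : ℝ → Ω → ℝ)
    (hCadlag : ∀ ω, CadlagOn (fun s => φ s ω) T)
    (hAdapted : ∀ t ∈ Set.Ico (0:ℝ) T, StronglyMeasurable[ℱ t] (φ t))
    (hlow : ∀ a b : ℝ, 0 ≤ a → a < b → b < T → ∀ Z : Ω → ℝ, Measurable[ℱ a] Z →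
      ∀ A : Set Ω, MeasurableSet[ℱ a] A →
        (∫⁻ ω in A, ENNReal.ofReal ((φ a ω - Z ω) ^ 2 / c) ∂μ)
          ≤ ∫⁻ ω in A,
              (∫⁻ u in Set.Ioc a b, ENNReal.ofReal ((φ u ω - Z ω) ^ 2)) /
                ENNReal.ofReal (b - a) ∂μ)
    (hosc : ∃ δ : ℝ, 0 < δ ∧ ∀ t ∈ Set.Ioo (0:ℝ) T,
      ENNReal.ofReal δ ≤ ENNReal.ofReal ((T - t) ^ ((1 - θ) / 2)) * oscLow μ φ t) :
    ∃ c' : ℝ, 0 < c' ∧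
      ∀ (n : ℕ) (t : ℕ → ℝ), IsTimeNet T n t →
      ∀ k < n, meshTheta T θ n t = (t (k + 1) - t k) / (T - t k) ^ (1 - θ) →
      ∀ ϑ : ℕ → Ω → ℝ, (∀ i < n, Measurable[ℱ (t i)] (ϑ i)) →
      ∀ M : ℝ≥0∞,
        (∀ a ∈ Set.Ico (t k) (t (k + 1)), ∀ A : Set Ω, MeasurableSet[ℱ a] A →
          (∫⁻ ω in A,
            (∫⁻ u in Set.Ioc a T, ENNReal.ofReal ((φ u ω - stepOf ϑ n t u ω) ^ 2)) ∂μ)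
            ≤ M * μ A) →
        ENNReal.ofReal (c' ^ 2 * meshTheta T θ n t) ≤ M := by
  
  obtain ⟨δ, hδ, hosc⟩ := hosc
  refine ⟨δ / (4 * Real.sqrt c), by positivity, ?_⟩
  intro n t hnet k hk hmesh ϑ hϑ M hM
  rw [hmesh]
  rcases eq_or_ne M ⊤ with rfl | hMtop
  · exact le_top
  lift M to NNReal using hMtop
  have h0k : 0 ≤ t k := by
    have := net_mono_aux hnet 0 k (Nat.zero_le _) hk.le
    rwa [hnet.2.1] at this
  have hk1 : t (k + 1) ≤ T := by
    have := net_mono_aux hnet (k + 1) n hk le_rfl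
    rwa [hnet.2.2.1] at this
  have hlt : t k < t (k + 1) := hnet.2.2.2 k hk
  set s := t k with hs
  obtain ⟨L, hL⟩ : ∃ L, L = t (k + 1) - s := ⟨_, rfl⟩
  have hLpos : 0 < L := by linarith
  have key : ∀ a b : ℝ, s ≤ a → a < b → b < t (k + 1) →
      ∀ᵐ ω ∂μ, (φ a ω - ϑ k ω) ^ 2 / c ≤ (M : ℝ) / (b - a) := by
    intro a b ha hab hb
    have hba : 0 < b - a := by linarith
    have hZ : Measurable[ℱ a] (ϑ k) := (hϑ k hk).mono (ℱ.mono ha) le_rfl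
    have hφ : Measurable[ℱ a] (φ a) := (hAdapted a ⟨by linarith, by linarith⟩).measurable
    have hg : Measurable[ℱ a] (fun ω => (φ a ω - ϑ k ω) ^ 2 / c) :=
      ((hφ.sub hZ).pow_const 2).div_const c
    have hA : MeasurableSet[ℱ a] {ω | (M : ℝ) / (b - a) < (φ a ω - ϑ k ω) ^ 2 / c} :=
      measurableSet_lt measurable_const hg
    refine ae_bound_aux _ (hg.mono (ℱ.le a) le_rfl) _ ?_ (by positivity)
    refine (hlow a b (by linarith) hab (by linarith) (ϑ k) hZ _ hA).trans ?_
    have h2 := hM a ⟨ha, by linarith⟩ _ hA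
    simp only [div_eq_mul_inv] at h2 ⊢
    rw [lintegral_mul_const' _ _ (by simpa using hab)]
    rw [ENNReal.ofReal_mul (by positivity), ENNReal.ofReal_inv_of_pos hba,
      ENNReal.ofReal_coe_nnreal, mul_right_comm]
    gcongr
    refine le_trans ?_ h2
    refine lintegral_mono fun ω => ?_
    calc _ = ∫⁻ u in Set.Ioc a b, ENNReal.ofReal ((φ u ω - stepOf ϑ n t u ω) ^ 2) := by
          refine setLIntegral_congr_fun measurableSet_Ioc ?_
          intro u hu
          simp only
          rw [step_aux hnet ϑ hk ⟨lt_of_le_of_lt ha hu.1, by linarith [hu.2]⟩]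
      _ ≤ _ := lintegral_mono_set (Set.Ioc_subset_Ioc_right (by linarith))
  have k1 := key s (s + L / 2) le_rfl (by linarith) (by linarith)
  have k2 := key (s + L / 2) (s + 3 * L / 4) (by linarith) (by linarith) (by linarith)
  obtain ⟨m, hm⟩ : ∃ m, m = s + L / 2 := ⟨_, rfl⟩
  rw [← hm] at k2
  have hmI : m ∈ Set.Ioo (0 : ℝ) T := ⟨by linarith, by linarith⟩
  have hbd : ∀ᵐ ω ∂μ, ‖φ m ω - φ s ω‖ ≤ Real.sqrt (16 * c * M / L) := by
    filter_upwards [k1, k2] with ω h1 h2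
    rw [Real.norm_eq_abs]
    apply Real.abs_le_sqrt
    have e1 : (M : ℝ) / (s + L / 2 - s) = 2 * (M / L) := by
      rw [add_sub_cancel_left]; field_simp
    have e2 : (M : ℝ) / (s + 3 * L / 4 - m) = 4 * (M / L) := by
      rw [hm]
      have : s + 3 * L / 4 - (s + L / 2) = L / 4 := by ring
      rw [this]; field_simp
    rw [e1, div_le_iff₀ hc] at h1
    rw [e2, div_le_iff₀ hc] at h2
    have e3 : 16 * c * M / L = 16 * (M / L * c) := by ring
    rw [e3]
    have : 0 ≤ (M : ℝ) / L * c := by positivity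
    nlinarith [sq_nonneg (φ m ω - ϑ k ω + (φ s ω - ϑ k ω))]
  have hess : eLpNorm (fun ω => φ m ω - φ s ω) ⊤ μ
      ≤ ENNReal.ofReal (Real.sqrt (16 * c * M / L)) := by
    rw [eLpNorm_exponent_top]
    exact eLpNormEssSup_le_of_ae_bound hbd
  have hfin : ENNReal.ofReal δ ≤ ENNReal.ofReal ((T - m) ^ ((1 - θ) / 2)
      * Real.sqrt (16 * c * M / L)) := by
    rw [ENNReal.ofReal_mul (Real.rpow_nonneg (by linarith [hmI.2]) _)]
    refine (hosc m hmI).trans ?_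
    gcongr
    refine le_trans ?_ hess
    exact iInf₂_le s ⟨h0k, by linarith⟩
  rw [ENNReal.ofReal_le_ofReal_iff (mul_nonneg (Real.rpow_nonneg (by linarith [hmI.2]) _)
    (Real.sqrt_nonneg _))] at hfin
  have hTs : 0 < T - s := by linarith
  have hr : (T - m) ^ ((1 - θ) / 2) ≤ (T - s) ^ ((1 - θ) / 2) :=
    Real.rpow_le_rpow (by linarith [hmI.2]) (by linarith) (by linarith [hθ.2])
  have hfin2 : δ ≤ (T - s) ^ ((1 - θ) / 2) * Real.sqrt (16 * c * M / L) :=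
    hfin.trans (mul_le_mul_of_nonneg_right hr (Real.sqrt_nonneg _))
  have hsq : δ ^ 2 ≤ (T - s) ^ (1 - θ) * (16 * c * M / L) := by
    calc δ ^ 2 ≤ ((T - s) ^ ((1 - θ) / 2) * Real.sqrt (16 * c * M / L)) ^ 2 := by gcongr
      _ = _ := by
        rw [mul_pow, Real.sq_sqrt (by positivity), ← Real.rpow_natCast, ← Real.rpow_mul hTs.le]
        congr 2
        push_cast
        ring
  have hP : 0 < (T - s) ^ (1 - θ) := Real.rpow_pos_of_pos hTs _
  rw [← ENNReal.ofReal_coe_nnreal]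
  apply ENNReal.ofReal_le_ofReal
  rw [div_pow, mul_pow, Real.sq_sqrt hc.le, ← hL, div_mul_div_comm, div_le_iff₀ (by positivity)]
  have h3 : δ ^ 2 * L ≤ (T - s) ^ (1 - θ) * (16 * c * M / L) * L :=
    mul_le_mul_of_nonneg_right hsq hLpos.le
  have h4 : (T - s) ^ (1 - θ) * (16 * c * M / L) * L = (T - s) ^ (1 - θ) * (16 * c * M) := by
    field_simp
  rw [h4] at h3
  linarith
end

section
/- Let T>0, θ∈[0,1], φ:[0,T)→ℝ a function, and Ψ:[0,T)→[0,∞) a non-decreasing function. Then the following assertions are equivalent: (1) there is a c>0 such that for all 0≤s≤a<T one has |φ_a − φ_s| ≤ c ((T−s)^{θ/2}/(T−a)^{1/2}) Ψ_a; (2) in the case θ∈[0,1): there is a c>0 such that for all a∈[0,T) one has |φ_a − φ_0| ≤ c (T−a)^{(θ−1)/2} Ψ_a; in the case θ=1: there is a c>0 such that for all 0≤s≤a<T one has |φ_a − φ_s| ≤ c (1 + ln((T−s)/(T−a))) Ψ_a. -/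
open Set

theorem wee_step {T θ c : ℝ} (hθ : θ ∈ Set.Icc (0:ℝ) 1) (hc : 0 < c) {φ Ψ : ℝ → ℝ}
    (hΨ0 : ∀ t ∈ Set.Ico (0:ℝ) T, 0 ≤ Ψ t)
    (h : ∀ s a : ℝ, 0 ≤ s → s ≤ a → a < T →
        |φ a - φ s| ≤ c * ((T - s) ^ (θ / 2) / (T - a) ^ ((1:ℝ) / 2)) * Ψ a)
    (s a : ℝ) (hs : 0 ≤ s) (hsa : s ≤ a) (ha : a < T) (h2 : T - s ≤ 2 * (T - a)) :
    |φ a - φ s| ≤ (c * 2 ^ (θ / 2)) * (T - a) ^ ((θ - 1) / 2) * Ψ a := by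
  refine (h s a hs hsa ha).trans ?_
  have hu : 0 < T - a := by linarith
  have hΨ := hΨ0 a ⟨by linarith, ha⟩
  refine mul_le_mul_of_nonneg_right ?_ hΨ
  rw [mul_assoc]
  refine mul_le_mul_of_nonneg_left ?_ hc.le
  have e : (T - a) ^ ((θ - 1) / 2) = (T - a) ^ (θ / 2) / (T - a) ^ ((1:ℝ) / 2) := by
    rw [← Real.rpow_sub hu]; congr 1; ring
  rw [e, ← mul_div_assoc, ← Real.mul_rpow (by norm_num) hu.le]
  have : (T - s) ^ (θ / 2) ≤ (2 * (T - a)) ^ (θ / 2) :=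
    Real.rpow_le_rpow (by linarith) h2 (by linarith [hθ.1])
  gcongr

/-- Equivalence of the two forms of the weight estimate for the gradient process
(`Lemma on upper bounds of the integrand`): for `θ ∈ [0,1]`, a function `φ : [0,T) → ℝ` and
a non-decreasing `Ψ : [0,T) → [0,∞)`, the bound
`|φ_a − φ_s| ≤ c (T−s)^{θ/2}/(T−a)^{1/2} Ψ_a` (for all `0 ≤ s ≤ a < T`) is equivalent to:
for `θ ∈ [0,1)`, `|φ_a − φ_0| ≤ c (T−a)^{(θ−1)/2} Ψ_a`, and for `θ = 1`,
`|φ_a − φ_s| ≤ c (1 + ln((T−s)/(T−a))) Ψ_a`. -/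
theorem weight_estimate_equivalence
    (T : ℝ) (hT : 0 < T) (θ : ℝ) (hθ : θ ∈ Set.Icc (0:ℝ) 1)
    (φ : ℝ → ℝ) (Ψ : ℝ → ℝ)
    (hΨ0 : ∀ t ∈ Set.Ico (0:ℝ) T, 0 ≤ Ψ t)
    (hΨmono : MonotoneOn Ψ (Set.Ico (0:ℝ) T)) :
    (∃ c : ℝ, 0 < c ∧ ∀ s a : ℝ, 0 ≤ s → s ≤ a → a < T →
        |φ a - φ s| ≤ c * ((T - s) ^ (θ / 2) / (T - a) ^ ((1:ℝ) / 2)) * Ψ a) ↔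
      ((θ < 1 → ∃ c : ℝ, 0 < c ∧ ∀ a : ℝ, 0 ≤ a → a < T →
          |φ a - φ 0| ≤ c * (T - a) ^ ((θ - 1) / 2) * Ψ a) ∧
       (θ = 1 → ∃ c : ℝ, 0 < c ∧ ∀ s a : ℝ, 0 ≤ s → s ≤ a → a < T →
          |φ a - φ s| ≤ c * (1 + Real.log ((T - s) / (T - a))) * Ψ a)) := by
  have pow_ex : ∀ s a : ℝ, a < T → ∃ n : ℕ, T - s ≤ 2 ^ (n + 1) * (T - a) := by
    intro s a ha
    have hu : 0 < T - a := by linarith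
    obtain ⟨n, hn⟩ := pow_unbounded_of_one_lt ((T - s) / (T - a)) (by norm_num : (1:ℝ) < 2)
    refine ⟨n, ?_⟩
    rw [div_lt_iff₀ hu] at hn
    have : (0:ℝ) < 2 ^ n * (T - a) := by positivity
    rw [pow_succ]; nlinarith
  constructor
  · rintro ⟨c, hc, h⟩
    have step := wee_step hθ hc hΨ0 h
    set d := c * 2 ^ (θ / 2) with hd
    have hd0 : 0 < d := by positivity
    constructor
    · intro h1
      set q : ℝ := 2 ^ ((θ - 1) / 2) with hq
      have hq1 : q < 1 := Real.rpow_lt_one_of_one_lt_of_neg (by norm_num) (by linarith)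
      have hq0 : 0 < q := by positivity
      have hq2 : 0 < 1 - q := by linarith
      have hC : d + d / (1 - q) * q = d / (1 - q) := by field_simp; ring
      have hdC : d ≤ d / (1 - q) := by
        rw [← hC]; have : 0 < d / (1 - q) * q := by positivity
        linarith
      have hC0 : 0 < d / (1 - q) := by positivity
      set C := d / (1 - q) with hCdef
      refine ⟨C, hC0, ?_⟩
      have key : ∀ n : ℕ, ∀ a : ℝ, 0 ≤ a → a < T → T - 0 ≤ 2 ^ (n + 1) * (T - a) →
          |φ a - φ 0| ≤ C * (T - a) ^ ((θ - 1) / 2) * Ψ a := by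
        intro n
        induction n with
        | zero =>
          intro a h0 ha hn
          have hu : 0 < T - a := by linarith
          have hΨ := hΨ0 a ⟨h0, ha⟩
          refine (step 0 a le_rfl h0 ha (by simpa using hn)).trans ?_
          gcongr
        | succ n ih =>
          intro a h0 ha hn
          have hu : 0 < T - a := by linarith
          have hΨ := hΨ0 a ⟨h0, ha⟩
          rcases le_total (T - 0) (2 * (T - a)) with h2 | h2
          · refine (step 0 a le_rfl h0 ha h2).trans ?_
            gcongr
          · have hb0 : 0 ≤ 2 * a - T := by linarith
            have hb1 : 2 * a - T ≤ a := by linarith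
            have hb : T - (2 * a - T) = 2 * (T - a) := by ring
            have i1 := ih (2 * a - T) hb0 (by linarith) (by
              rw [hb]; rw [pow_succ] at hn; linarith)
            have i2 := step (2 * a - T) a hb0 hb1 ha hb.le
            rw [hb, Real.mul_rpow (by norm_num) hu.le, ← hq] at i1
            have hm := hΨmono ⟨hb0, by linarith⟩ ⟨h0, ha⟩ hb1
            have i3 : |φ (2 * a - T) - φ 0| ≤ C * (q * (T - a) ^ ((θ - 1) / 2)) * Ψ a :=
              i1.trans (by gcongr)
            have i4 := abs_sub_le (φ a) (φ (2 * a - T)) (φ 0)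
            calc _ ≤ (d + C * q) * (T - a) ^ ((θ - 1) / 2) * Ψ a := by linarith
              _ = _ := by rw [hC]
      intro a h0 ha
      obtain ⟨n, hn⟩ := pow_ex 0 a ha
      exact key n a h0 ha hn
    · intro h1
      have step' : ∀ s a : ℝ, 0 ≤ s → s ≤ a → a < T → T - s ≤ 2 * (T - a) →
          |φ a - φ s| ≤ d * Ψ a := by
        intro s a hs hsa ha h2
        have := step s a hs hsa ha h2
        simpa [h1] using this
      have hl : (1:ℝ) / 2 < Real.log 2 := by linarith [Real.log_two_gt_d9]
      have base : ∀ s a : ℝ, 0 ≤ s → s ≤ a → a < T → T - s ≤ 2 * (T - a) →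
          |φ a - φ s| ≤ 2 * d * (1 + Real.log ((T - s) / (T - a))) * Ψ a := by
        intro s a hs hsa ha h2
        have hu : 0 < T - a := by linarith
        have hΨ := hΨ0 a ⟨by linarith, ha⟩
        refine (step' s a hs hsa ha h2).trans ?_
        have : 0 ≤ Real.log ((T - s) / (T - a)) :=
          Real.log_nonneg (by rw [le_div_iff₀ hu]; linarith)
        refine mul_le_mul_of_nonneg_right ?_ hΨ
        nlinarith
      refine ⟨2 * d, by positivity, ?_⟩
      have key : ∀ n : ℕ, ∀ s a : ℝ, 0 ≤ s → s ≤ a → a < T → T - s ≤ 2 ^ (n + 1) * (T - a) →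
          |φ a - φ s| ≤ 2 * d * (1 + Real.log ((T - s) / (T - a))) * Ψ a := by
        intro n
        induction n with
        | zero =>
          intro s a hs hsa ha hn
          exact base s a hs hsa ha (by simpa using hn)
        | succ n ih =>
          intro s a hs hsa ha hn
          rcases le_total (T - s) (2 * (T - a)) with h2 | h2
          · exact base s a hs hsa ha h2
          · have hu : 0 < T - a := by linarith
            have hv : 0 < T - s := by linarith
            have hΨ := hΨ0 a ⟨by linarith, ha⟩
            have hb0 : s ≤ 2 * a - T := by linarith
            have hb1 : 2 * a - T ≤ a := by linarith
            have hb : T - (2 * a - T) = 2 * (T - a) := by ring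
            have i1 := ih s (2 * a - T) hs hb0 (by linarith) (by
              rw [hb]; rw [pow_succ] at hn; linarith)
            have i2 := step' (2 * a - T) a (by linarith) hb1 ha hb.le
            have hm := hΨmono ⟨by linarith, by linarith⟩ ⟨by linarith, ha⟩ hb1
            have hl0 : 0 ≤ Real.log ((T - s) / (2 * (T - a))) :=
              Real.log_nonneg (by rw [le_div_iff₀ (by positivity)]; linarith)
            rw [hb] at i1
            have i3 : |φ (2 * a - T) - φ s| ≤
                2 * d * (1 + Real.log ((T - s) / (2 * (T - a)))) * Ψ a :=
              i1.trans (by gcongr)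
            have e : Real.log ((T - s) / (2 * (T - a))) =
                Real.log ((T - s) / (T - a)) - Real.log 2 := by
              rw [Real.log_div hv.ne' (by positivity), Real.log_mul (by norm_num) hu.ne',
                Real.log_div hv.ne' hu.ne']; ring
            rw [e] at i3
            have i4 := abs_sub_le (φ a) (φ (2 * a - T)) (φ s)
            have i5 : 0 ≤ (d * Ψ a) * (Real.log 2 - 1 / 2) :=
              mul_nonneg (by positivity) (by linarith)
            linarith
      intro s a hs hsa ha
      obtain ⟨n, hn⟩ := pow_ex s a ha
      exact key n s a hs hsa ha hn
  · rintro ⟨hA, hB⟩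
    rcases hθ.2.lt_or_eq with h1 | h1
    · obtain ⟨c, hc, h⟩ := hA h1
      refine ⟨2 * c, by positivity, ?_⟩
      intro s a hs hsa ha
      have hu : 0 < T - a := by linarith
      have hv : 0 < T - s := by linarith
      have hΨ := hΨ0 a ⟨by linarith, ha⟩
      have hm := hΨmono ⟨hs, by linarith⟩ ⟨by linarith, ha⟩ hsa
      have i1 := h a (by linarith) ha
      have i2 := h s hs (by linarith)
      have hw : (T - s) ^ ((θ - 1) / 2) ≤ (T - a) ^ ((θ - 1) / 2) :=
        Real.rpow_le_rpow_of_nonpos hu (by linarith) (by linarith)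
      have hΨs := hΨ0 s ⟨hs, by linarith⟩
      have i3 : |φ s - φ 0| ≤ c * (T - a) ^ ((θ - 1) / 2) * Ψ a := i2.trans (by gcongr)
      have i4 := abs_sub_le (φ a) (φ 0) (φ s)
      rw [abs_sub_comm (φ 0)] at i4
      have e : (T - a) ^ ((θ - 1) / 2) = (T - a) ^ (θ / 2) / (T - a) ^ ((1:ℝ) / 2) := by
        rw [← Real.rpow_sub hu]; congr 1; ring
      have hw2 : (T - a) ^ (θ / 2) ≤ (T - s) ^ (θ / 2) :=
        Real.rpow_le_rpow hu.le (by linarith) (by linarith [hθ.1])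
      calc _ ≤ 2 * c * (T - a) ^ ((θ - 1) / 2) * Ψ a := by linarith
        _ ≤ _ := by rw [e]; gcongr
    · obtain ⟨c, hc, h⟩ := hB h1
      refine ⟨2 * c, by positivity, ?_⟩
      intro s a hs hsa ha
      have hu : 0 < T - a := by linarith
      have hv : 0 < T - s := by linarith
      have hΨ := hΨ0 a ⟨by linarith, ha⟩
      refine (h s a hs hsa ha).trans (mul_le_mul_of_nonneg_right ?_ hΨ)
      rw [h1, ← Real.div_rpow hv.le hu.le, Real.rpow_def_of_pos (by positivity)]
      have := Real.add_one_le_exp (Real.log ((T - s) / (T - a)) * (1 / 2))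
      nlinarith
end

section
/- Let ν and ρ be probability measures on (ℝ,B(ℝ)). For v∈ℝ and z≠0 set J(v;z) := v + [−z⁺, z⁻) (the half-open interval of length |z| adjacent to v on the side determined by the sign of z, where z⁺=max{z,0}, z⁻=max{−z,0}), and define γ:ℝ→[0,∞] by γ(v) := ∫_{ℝ∖{0}} ν(J(v;z))/|z| ρ(dz). Then: (1) ∫_ℝ γ(v) dv = ρ(ℝ∖{0}); (2) if q,r∈[1,∞], s := min{q,r}, and ν has a density p with respect to Lebesgue measure with p∈L_r(ℝ), then ‖γ‖_{L_q(ℝ)} ≤ ‖p‖_{L_s(ℝ)} · ∫_{ℝ∖{0}} |z|^{1/q − 1/s} ρ(dz). -/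
open MeasureTheory Set ENNReal

/-- The half-open interval `J(v;z) := v + [−z⁺, z⁻) = [v − z⁺, v + z⁻)` of length `|z|`. -/
def Jset (v z : ℝ) : Set ℝ := Set.Ico (v - max z 0) (v + max (-z) 0)

/-- The `L_q(ℝ)`-norm (with respect to Lebesgue measure) of a `[0,∞]`-valued function,
for an exponent `q ∈ [1,∞]`. -/
noncomputable def lqNorm (q : ℝ≥0∞) (g : ℝ → ℝ≥0∞) : ℝ≥0∞ :=
  if q = ⊤ then essSup g MeasureTheory.volume
  else (∫⁻ v, g v ^ q.toReal) ^ (1 / q.toReal)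

lemma holderA {α : Type*} [MeasurableSpace α] (μ : Measure α) (f w : α → ℝ≥0∞) (hf : Measurable f)
    (hw : Measurable w) (q : ℝ) (hq : 1 ≤ q) :
    (∫⁻ x, f x * w x ∂μ) ^ q ≤ (∫⁻ x, f x ^ q * w x ∂μ) * (∫⁻ x, w x ∂μ) ^ (q - 1) := by
  rcases hq.eq_or_lt with h | h
  · subst h; simp
  · have hc : q.HolderConjugate (q / (q - 1)) := Real.HolderConjugate.conjExponent h
    have hq0 : 0 < q := by linarith
    have hq1 : 0 < q - 1 := by linarith
    have H := ENNReal.lintegral_mul_le_Lp_mul_Lq μ hc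
      (f := fun x => f x * w x ^ (1 / q)) (g := fun x => w x ^ ((q - 1) / q))
      (hf.mul (hw.pow_const _)).aemeasurable (hw.pow_const _).aemeasurable
    have e1 : ∀ x, ((fun x => f x * w x ^ (1 / q)) * (fun x => w x ^ ((q - 1) / q))) x
        = f x * w x := by
      intro x
      simp only [Pi.mul_apply]
      rw [mul_assoc, ← ENNReal.rpow_add_of_nonneg _ _ (by positivity) (by positivity)]
      have : 1 / q + (q - 1) / q = 1 := by field_simp; ring
      rw [this, ENNReal.rpow_one]
    have e2 : ∀ x, (f x * w x ^ (1 / q)) ^ q = f x ^ q * w x := by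
      intro x
      rw [ENNReal.mul_rpow_of_nonneg _ _ hq0.le, ← ENNReal.rpow_mul]
      have : 1 / q * q = 1 := by field_simp
      rw [this, ENNReal.rpow_one]
    have e3 : ∀ x, (w x ^ ((q - 1) / q)) ^ (q / (q - 1)) = w x := by
      intro x
      rw [← ENNReal.rpow_mul]
      have : (q - 1) / q * (q / (q - 1)) = 1 := by field_simp
      rw [this, ENNReal.rpow_one]
    simp only [e1, e2, e3] at H
    calc _ ≤ _ := ENNReal.rpow_le_rpow H hq0.le
      _ = _ := by
        rw [ENNReal.mul_rpow_of_nonneg _ _ hq0.le, ← ENNReal.rpow_mul, ← ENNReal.rpow_mul]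
        have h1 : 1 / q * q = 1 := by field_simp
        have h2 : 1 / (q / (q - 1)) * q = q - 1 := by field_simp
        rw [h1, h2, ENNReal.rpow_one]

lemma measJ : MeasurableSet {x : (ℝ × ℝ) × ℝ | x.2 ∈ Jset x.1.1 x.1.2} := by
  have : {x : (ℝ × ℝ) × ℝ | x.2 ∈ Jset x.1.1 x.1.2} =
    {x | x.1.1 - max x.1.2 0 ≤ x.2} ∩ {x | x.2 < x.1.1 + max (-x.1.2) 0} := by
    ext x; simp [Jset]
  rw [this]
  exact (measurableSet_le (by fun_prop) (by fun_prop)).inter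
    (measurableSet_lt (by fun_prop) (by fun_prop))

lemma measF (μ : Measure ℝ) [SFinite μ] :
    Measurable (fun x : ℝ × ℝ => μ (Jset x.1 x.2)) :=
  measurable_measure_prodMk_left measJ

lemma measF1 (μ : Measure ℝ) [SFinite μ] (z : ℝ) :
    Measurable (fun v : ℝ => μ (Jset v z)) :=
  (measF μ).comp (measurable_id.prodMk measurable_const)

lemma max_abs (z : ℝ) : max z 0 + max (-z) 0 = |z| := by
  rcases le_total 0 z with h | h
  · simp [h, abs_of_nonneg h]
  · simp [h, abs_of_nonpos h]

lemma volJ (v z : ℝ) : volume (Jset v z) = ENNReal.ofReal |z| := by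
  rw [Jset, Real.volume_Ico, ← max_abs]; congr 1; ring

lemma intJ (μ : Measure ℝ) [SFinite μ] (z : ℝ) :
    ∫⁻ v, μ (Jset v z) = μ univ * ENNReal.ofReal |z| := by
  have hS : MeasurableSet {x : ℝ × ℝ | x.2 ∈ Jset x.1 z} :=
    measJ.preimage (f := fun x : ℝ × ℝ => ((x.1, z), x.2)) (by fun_prop)
  have h1 := Measure.prod_apply (μ := (volume : Measure ℝ)) (ν := μ) hS
  have h2 := Measure.prod_apply_symm (μ := (volume : Measure ℝ)) (ν := μ) hS
  have h3 : ∀ y : ℝ, volume ((fun x => (x, y)) ⁻¹' {x : ℝ × ℝ | x.2 ∈ Jset x.1 z})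
      = ENNReal.ofReal |z| := by
    intro y
    have : ((fun x => (x, y)) ⁻¹' {x : ℝ × ℝ | x.2 ∈ Jset x.1 z})
        = Ioc (y - max (-z) 0) (y + max z 0) := by
      ext v
      simp only [Jset, mem_preimage, mem_ofPred_eq, mem_Ico, mem_Ioc]
      constructor <;> rintro ⟨a, b⟩ <;> constructor <;> linarith
    rw [this, Real.volume_Ioc, ← max_abs]; congr 1; ring
  rw [h1] at h2
  simp only [h3, lintegral_const] at h2
  rw [mul_comm, ← h2]
  rfl

lemma powJ (g : ℝ → ℝ≥0∞) (hg : Measurable g) (s : ℝ) (hs : 1 ≤ s) (v z : ℝ) :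
    (volume.withDensity g (Jset v z)) ^ s ≤
      volume.withDensity (fun y => g y ^ s) (Jset v z) * ENNReal.ofReal |z| ^ (s - 1) := by
  have hm : MeasurableSet (Jset v z) := measurableSet_Ico
  have := holderA (volume.restrict (Jset v z)) g (fun _ => 1) hg measurable_const s hs
  simp only [mul_one, lintegral_const, Measure.restrict_apply_univ, one_mul, volJ] at this
  rwa [withDensity_apply _ hm, withDensity_apply _ hm]

/-- pointwise bound on the average -/
lemma avgJ (g : ℝ → ℝ≥0∞) (hg : Measurable g) (s : ℝ) (hs : 1 ≤ s) (v z : ℝ) (hz : z ≠ 0) :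
    (volume.withDensity g (Jset v z) / ENNReal.ofReal |z|) ^ s ≤
      volume.withDensity (fun y => g y ^ s) (Jset v z) / ENNReal.ofReal |z| := by
  have ha0 : ENNReal.ofReal |z| ≠ 0 := by simpa using hz
  have hat : ENNReal.ofReal |z| ≠ ⊤ := ENNReal.ofReal_ne_top
  rw [ENNReal.div_rpow_of_nonneg _ _ (by linarith)]
  refine (ENNReal.div_le_div_right (powJ g hg s hs v z) _).trans_eq ?_
  rw [div_eq_mul_inv, div_eq_mul_inv, mul_assoc, ← ENNReal.rpow_neg, ← ENNReal.rpow_add _ _ ha0 hat,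
    ← ENNReal.rpow_neg_one]
  congr 2; ring

/-- the L_q bound for a fixed z -/
lemma lqJ (g : ℝ → ℝ≥0∞) (hg : Measurable g) (s q : ℝ) (hs : 1 ≤ s) (hsq : s ≤ q) (z : ℝ)
    (hz : z ≠ 0) :
    ∫⁻ v, (volume.withDensity g (Jset v z) / ENNReal.ofReal |z|) ^ q ≤
      (∫⁻ y, g y ^ s) ^ (q / s) * ENNReal.ofReal |z| ^ (1 - q / s) := by
  have ha0 : ENNReal.ofReal |z| ≠ 0 := by simpa using hz
  have hat : ENNReal.ofReal |z| ≠ ⊤ := ENNReal.ofReal_ne_top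
  set a := ENNReal.ofReal |z| with ha
  set A := ∫⁻ y, g y ^ s with hA
  have hs0 : 0 < s := by linarith
  have he : 0 ≤ (q - s) / s := div_nonneg (by linarith) hs0.le
  have hAu : volume.withDensity (fun y => g y ^ s) univ = A := by simp [hA]
  have key : ∀ v, (volume.withDensity g (Jset v z) / a) ^ q ≤
      (A / a) ^ ((q - s) / s) * a⁻¹ * volume.withDensity (fun y => g y ^ s) (Jset v z) := by
    intro v
    have h1 := avgJ g hg s hs v z hz
    have h2 : (volume.withDensity g (Jset v z) / a) ^ s ≤ A / a :=
      h1.trans (ENNReal.div_le_div_right ((measure_mono (subset_univ _)).trans_eq hAu) _)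
    have : (volume.withDensity g (Jset v z) / a) ^ q =
      ((volume.withDensity g (Jset v z) / a) ^ s) ^ ((q - s) / s) *
        (volume.withDensity g (Jset v z) / a) ^ s := by
      rw [← ENNReal.rpow_mul, ← ENNReal.rpow_add_of_nonneg _ _ (by positivity) hs0.le]
      congr 1; field_simp; ring
    rw [this, mul_assoc, mul_comm a⁻¹, ← div_eq_mul_inv]
    exact mul_le_mul' (ENNReal.rpow_le_rpow h2 he) h1
  refine (lintegral_mono key).trans_eq ?_
  rw [lintegral_const_mul _ (measF1 _ z), intJ, hAu, ← ha]
  have : (A / a) ^ ((q - s) / s) * a⁻¹ * (A * a) = (A / a) ^ ((q - s) / s) * A * (a⁻¹ * a) := by ring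
  rw [this, ENNReal.inv_mul_cancel ha0 hat, mul_one, ENNReal.div_rpow_of_nonneg _ _ he,
    div_eq_mul_inv, ← ENNReal.rpow_neg, mul_right_comm]
  have h3 : A ^ ((q - s) / s) * A = A ^ (q / s) := by
    conv_lhs => rw [← ENNReal.rpow_one A, ← ENNReal.rpow_mul]
    rw [← ENNReal.rpow_add_of_nonneg _ _ (by simpa using he) zero_le_one]
    congr 1; field_simp; ring
  rw [h3]
  congr 2; field_simp; ring

lemma ofReal_w (z e : ℝ) (hz : z ≠ 0) :
    ENNReal.ofReal (|z| ^ e) = ENNReal.ofReal |z| ^ e :=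
  (ENNReal.ofReal_rpow_of_pos (abs_pos.2 hz)).symm

/-- Properties of `γ(v) = ∫_{ℝ∖{0}} ν(J(v;z))/|z| ρ(dz)`:
(1) `∫_ℝ γ(v) dv = ρ(ℝ∖{0})`;
(2) if `ν` has a density `p ∈ L_r(ℝ)` and `s := min{q,r}` for `q,r ∈ [1,∞]`, then
`‖γ‖_{L_q(ℝ)} ≤ ‖p‖_{L_s(ℝ)} ∫_{ℝ∖{0}} |z|^{1/q − 1/s} ρ(dz)`. -/
theorem gamma_density_properties
    (ν ρ : Measure ℝ) [IsProbabilityMeasure ν] [IsProbabilityMeasure ρ]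
    (γ : ℝ → ℝ≥0∞)
    (hγ : ∀ v : ℝ, γ v = ∫⁻ z in ({0}ᶜ : Set ℝ), ν (Jset v z) / ENNReal.ofReal |z| ∂ρ) :
    (∫⁻ v, γ v) = ρ ({0}ᶜ : Set ℝ) ∧
    (∀ q r : ℝ≥0∞, 1 ≤ q → 1 ≤ r →
      ∀ p : ℝ → ℝ, Measurable p → (∀ y, 0 ≤ p y) →
      ν = MeasureTheory.volume.withDensity (fun y => ENNReal.ofReal (p y)) →
      lqNorm r (fun y => ENNReal.ofReal (p y)) < ⊤ →
      lqNorm q γ ≤ lqNorm (min q r) (fun y => ENNReal.ofReal (p y)) *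
        ∫⁻ z in ({0}ᶜ : Set ℝ),
          ENNReal.ofReal (|z| ^ (q⁻¹.toReal - (min q r)⁻¹.toReal)) ∂ρ) := by
  have hae : ∀ᵐ z ∂(ρ.restrict ({0}ᶜ : Set ℝ)), z ≠ 0 :=
    ae_restrict_mem (measurableSet_singleton (0 : ℝ)).compl
  have hmeas : Measurable (fun x : ℝ × ℝ => ν (Jset x.1 x.2) / ENNReal.ofReal |x.2|) :=
    (measF ν).div (by fun_prop)
  obtain rfl : γ = _ := funext hγ
  constructor
  · rw [lintegral_lintegral_swap hmeas.aemeasurable]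
    rw [← setLIntegral_one]
    refine lintegral_congr_ae (hae.mono fun z hz => ?_)
    have ha0 : ENNReal.ofReal |z| ≠ 0 := by simpa using hz
    simp only [div_eq_mul_inv]
    rw [lintegral_mul_const _ (measF1 _ z), intJ,
      measure_univ, one_mul, ENNReal.mul_inv_cancel ha0 ENNReal.ofReal_ne_top]
  · intro q r hq hr p hp _ hν _
    set g : ℝ → ℝ≥0∞ := fun y => ENNReal.ofReal (p y) with hgdef
    have hg : Measurable g := hp.ennreal_ofReal
    by_cases hqt : q = ⊤
    · subst hqt
      rw [lqNorm, if_pos rfl]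
      refine essSup_le_of_ae_le _ (Filter.Eventually.of_forall fun v => ?_)
      have hmw : Measurable fun z : ℝ =>
        ENNReal.ofReal (|z| ^ ((⊤ : ℝ≥0∞)⁻¹.toReal - (min ⊤ r)⁻¹.toReal)) := by fun_prop
      show ∫⁻ z in ({0}ᶜ : Set ℝ), ν (Jset v z) / ENNReal.ofReal |z| ∂ρ ≤ _
      rw [← lintegral_const_mul _ hmw]
      refine lintegral_mono_ae (hae.mono fun z hz => ?_)
      have ha0 : ENNReal.ofReal |z| ≠ 0 := by simpa using hz
      rw [ofReal_w _ _ hz]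
      have hm : MeasurableSet (Jset v z) := measurableSet_Ico
      simp only [le_top, min_eq_right, ENNReal.inv_top, ENNReal.toReal_zero, zero_sub]
      by_cases hrt : r = ⊤
      · subst hrt
        rw [lqNorm, if_pos rfl]
        simp only [ENNReal.inv_top, ENNReal.toReal_zero, neg_zero, ENNReal.rpow_zero, mul_one]
        refine ENNReal.div_le_of_le_mul ?_
        rw [hν, withDensity_apply _ hm, ← volJ v z, ← setLIntegral_const]
        exact lintegral_mono_ae (ae_restrict_of_ae (ENNReal.ae_le_essSup g))
      · rw [lqNorm, if_neg hrt]
        have hs : 1 ≤ r.toReal := by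
          simpa using (ENNReal.toReal_le_toReal ENNReal.one_ne_top hrt).2 hr
        have hs0 : 0 < r.toReal := by linarith
        have h1 := avgJ g hg r.toReal hs v z hz
        rw [← hν] at h1
        have h2 := h1.trans (ENNReal.div_le_div_right (measure_mono (subset_univ _)) _)
        rw [withDensity_apply _ MeasurableSet.univ, Measure.restrict_univ] at h2
        rw [← ENNReal.rpow_le_rpow_iff hs0]
        refine h2.trans_eq ?_
        rw [ENNReal.mul_rpow_of_nonneg _ _ hs0.le, ← ENNReal.rpow_mul, ← ENNReal.rpow_mul,
          ENNReal.toReal_inv, one_div, inv_mul_cancel₀ hs0.ne', neg_mul, inv_mul_cancel₀ hs0.ne',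
          ENNReal.rpow_one, ENNReal.rpow_neg_one, div_eq_mul_inv]
    · have hst : min q r ≠ ⊤ := ne_top_of_le_ne_top hqt (min_le_left _ _)
      have hs1 : 1 ≤ min q r := le_min hq hr
      have hsq' : min q r ≤ q := min_le_left _ _
      generalize min q r = s at hst hs1 hsq'
      rw [lqNorm, if_neg hqt, lqNorm, if_neg hst, ENNReal.toReal_inv, ENNReal.toReal_inv]
      have hs : 1 ≤ s.toReal := by
        simpa using (ENNReal.toReal_le_toReal ENNReal.one_ne_top hst).2 hs1
      have hsq : s.toReal ≤ q.toReal := (ENNReal.toReal_le_toReal hst hqt).2 hsq'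
      generalize s.toReal = s at hs hsq
      generalize q.toReal = q at hsq
      have hs0 : 0 < s := by linarith
      have hq0 : 0 < q := by linarith
      set e := q⁻¹ - s⁻¹ with he
      set A := ∫⁻ y, g y ^ s with hA
      set W := ∫⁻ z in ({0}ᶜ : Set ℝ), ENNReal.ofReal (|z| ^ e) ∂ρ with hW
      have hmw : Measurable fun z : ℝ => ENNReal.ofReal (|z| ^ e) := by fun_prop
      have hma : Measurable fun z : ℝ => ENNReal.ofReal |z| ^ (-e) := by fun_prop
      have key : ∀ v, (∫⁻ z in ({0}ᶜ : Set ℝ), ν (Jset v z) / ENNReal.ofReal |z| ∂ρ) ^ q ≤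
          (∫⁻ z in ({0}ᶜ : Set ℝ), (ν (Jset v z) / ENNReal.ofReal |z| *
            ENNReal.ofReal |z| ^ (-e)) ^ q * ENNReal.ofReal (|z| ^ e) ∂ρ) * W ^ (q - 1) := by
        intro v
        have H := holderA (ρ.restrict ({0}ᶜ : Set ℝ))
          (fun z => ν (Jset v z) / ENNReal.ofReal |z| * ENNReal.ofReal |z| ^ (-e))
          (fun z => ENNReal.ofReal (|z| ^ e))
          ((hmeas.comp (measurable_const.prodMk measurable_id)).mul hma) hmw q (hs.trans hsq)
        refine le_trans (le_of_eq ?_) H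
        congr 1
        refine lintegral_congr_ae (hae.mono fun z hz => ?_)
        have ha0 : ENNReal.ofReal |z| ≠ 0 := by simpa using hz
        simp only
        rw [ofReal_w _ _ hz, mul_assoc, ← ENNReal.rpow_add _ _ ha0 ENNReal.ofReal_ne_top]
        simp
      have hjm : Measurable (fun x : ℝ × ℝ => (ν (Jset x.1 x.2) / ENNReal.ofReal |x.2| *
            ENNReal.ofReal |x.2| ^ (-e)) ^ q * ENNReal.ofReal (|x.2| ^ e)) :=
        ((hmeas.mul (hma.comp measurable_snd)).pow_const q).mul (hmw.comp measurable_snd)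
      have main : ∫⁻ v, (∫⁻ z in ({0}ᶜ : Set ℝ), ν (Jset v z) / ENNReal.ofReal |z| ∂ρ) ^ q ≤
          A ^ (q / s) * W * W ^ (q - 1) := by
        refine (lintegral_mono key).trans ?_
        rw [lintegral_mul_const _ hjm.lintegral_prod_right']
        gcongr
        rw [lintegral_lintegral_swap hjm.aemeasurable, hW, ← lintegral_const_mul _ hmw]
        refine lintegral_mono_ae (hae.mono fun z hz => ?_)
        have ha0 : ENNReal.ofReal |z| ≠ 0 := by simpa using hz
        have hat : ENNReal.ofReal |z| ≠ ⊤ := ENNReal.ofReal_ne_top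
        have hfz : Measurable fun v => ν (Jset v z) / ENNReal.ofReal |z| :=
          hmeas.comp (measurable_id.prodMk measurable_const)
        simp only [ENNReal.mul_rpow_of_nonneg _ _ hq0.le, mul_assoc]
        rw [lintegral_mul_const _ (hfz.pow_const q)]
        have h1 := lqJ g hg s q hs hsq z hz
        rw [← hν] at h1
        refine (mul_le_mul_left h1 _).trans_eq ?_
        rw [ofReal_w _ _ hz, mul_assoc, ← mul_assoc (_ ^ (1 - q / s)), ← ENNReal.rpow_mul,
          ← ENNReal.rpow_add _ _ ha0 hat]
        have : 1 - q / s + -e * q = 0 := by rw [he]; field_simp; ring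
        rw [this, ENNReal.rpow_zero, one_mul]
      have hWW : W * W ^ (q - 1) = W ^ q := by
        conv_lhs => rw [← ENNReal.rpow_one W, ← ENNReal.rpow_mul, one_mul]
        rw [← ENNReal.rpow_add_of_nonneg _ _ zero_le_one (by linarith)]
        congr 1; ring
      rw [mul_assoc, hWW] at main
      refine (ENNReal.rpow_le_rpow main (by positivity : 0 ≤ 1 / q)).trans_eq ?_
      rw [ENNReal.mul_rpow_of_nonneg _ _ (by positivity), ← ENNReal.rpow_mul, ← ENNReal.rpow_mul]
      have h1 : q / s * (1 / q) = 1 / s := by field_simp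
      have h2 : q * (1 / q) = 1 := by field_simp
      rw [h1, h2, ENNReal.rpow_one]
end

section
/- Let σ>0 and s>0, let G be a centered Gaussian random variable with variance s, and let J be a real random variable independent of G. Then the random variable X := σG + J has a law that is absolutely continuous with a continuously differentiable density p given by p(y) = E[φ_{σ²s}(y − J)], where φ_v is the density of the centered Gaussian with variance v, and this density satisfies ∫_ℝ |p'(y)| dy ≤ √(2/(πσ²)) · s^{−1/2}. Consequently, for every z∈ℝ, ‖ law(z+X) − law(X) ‖_{TV} ≤ √(2/(πσ²)) · |z| · s^{−1/2}. -/
open MeasureTheory Set ENNReal NNReal ProbabilityTheory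

/-- The total variation distance `‖μ − ν‖_TV` of two (finite) measures, via the Jordan
decomposition: `|μ−ν|(ℝ) = sup_B (μ(B) − ν(B)) + sup_B (ν(B) − μ(B))`, the suprema being
taken over measurable sets (subtraction is the truncated subtraction of `ℝ≥0∞`). -/
noncomputable def tvDist {α : Type*} [MeasurableSpace α] (μ ν : Measure α) : ℝ≥0∞ :=
  (⨆ B : {B : Set α // MeasurableSet B}, (μ B - ν B)) +
    ⨆ B : {B : Set α // MeasurableSet B}, (ν B - μ B)

open Filter Topology Real in
lemma gsd_psi_deriv (v : ℝ≥0) (hv : 0 < v) (x : ℝ) :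
    HasDerivAt (gaussianPDFReal 0 v) (-(x / v) * gaussianPDFReal 0 v x) x := by
  have hv' : (v:ℝ) ≠ 0 := by positivity
  rw [gaussianPDFReal_def]
  have h1 : HasDerivAt (fun x : ℝ => -(x - 0) ^ 2 / (2 * (v:ℝ))) (-(x / v)) x := by
    have := ((((hasDerivAt_id x).sub_const 0).pow 2).neg).div_const (2 * (v:ℝ))
    convert! this using 1
    simp; field_simp
  have h2 := (h1.exp).const_mul (√(2 * π * v))⁻¹
  convert! h2 using 1
  ring

lemma gsd_phi_cont (v : ℝ≥0) : Continuous (gaussianPDFReal 0 v) := by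
  rw [gaussianPDFReal_def]; fun_prop

lemma gsd_psi_cont (v : ℝ≥0) : Continuous (fun x : ℝ => -(x / v) * gaussianPDFReal 0 v x) := by
  have := gsd_phi_cont v
  fun_prop

open Real in
lemma gsd_phi_bound (v : ℝ≥0) (x : ℝ) : ‖gaussianPDFReal 0 v x‖ ≤ (√(2 * π * v))⁻¹ := by
  rw [Real.norm_of_nonneg (gaussianPDFReal_nonneg _ _ _), gaussianPDFReal_def]
  refine mul_le_of_le_one_right (by positivity) ?_
  rw [Real.exp_le_one_iff]
  have : 0 ≤ (x - 0) ^ 2 / (2 * (v:ℝ)) := by positivity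
  rw [neg_div]; linarith

open Real in
lemma gsd_psi_bound (v : ℝ≥0) (hv : 0 < v) : ∃ C : ℝ, ∀ x : ℝ,
    ‖-(x / v) * gaussianPDFReal 0 v x‖ ≤ C := by
  have hv' : (0:ℝ) < v := by positivity
  refine ⟨(1 + 2 * v) * ((v:ℝ)⁻¹ * (√(2 * π * v))⁻¹), fun x => ?_⟩
  rw [norm_mul, Real.norm_of_nonneg (gaussianPDFReal_nonneg _ _ _), gaussianPDFReal_def, norm_neg,
    norm_div, Real.norm_of_nonneg hv'.le, Real.norm_eq_abs]
  have key : |x| * rexp (-(x - 0) ^ 2 / (2 * v)) ≤ 1 + 2 * v := by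
    have h1 := Real.add_one_le_exp ((x - 0) ^ 2 / (2 * (v:ℝ)))
    rw [neg_div, Real.exp_neg, ← div_eq_mul_inv, div_le_iff₀ (Real.exp_pos _)]
    refine le_trans ?_ (mul_le_mul_of_nonneg_left h1 (by positivity))
    have : (1 + 2 * (v:ℝ)) * ((x - 0) ^ 2 / (2 * v) + 1)
      = x ^ 2 / (2 * v) + x ^ 2 + 1 + 2 * v := by field_simp; ring
    rw [this]
    have : 0 ≤ x ^ 2 / (2 * (v:ℝ)) := by positivity
    nlinarith [sq_nonneg (|x| - 1), sq_abs x, abs_nonneg x]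
  calc _ = (|x| * rexp (-(x - 0) ^ 2 / (2 * v))) * ((v:ℝ)⁻¹ * (√(2 * π * v))⁻¹) := by
        simp only [div_eq_mul_inv]; ring
    _ ≤ _ := by gcongr

open Real Filter Topology in
lemma gsd_psi_int (v : ℝ≥0) (hv : 0 < v) :
    ∫⁻ x : ℝ, ENNReal.ofReal |-(x / v) * gaussianPDFReal 0 v x|
      = ENNReal.ofReal (√(2 / (π * v))) := by
  have hv' : (0:ℝ) < v := by positivity
  have hint : Integrable (fun x : ℝ => -(x / v) * gaussianPDFReal 0 v x) := by
    have := (integrable_mul_exp_neg_mul_sq (b := 1 / (2 * (v:ℝ))) (by positivity)).const_mul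
      (-(v:ℝ)⁻¹ * (√(2 * π * v))⁻¹)
    refine this.congr (ae_of_all _ fun x => ?_)
    simp only [gaussianPDFReal_def, sub_zero]
    have : -(1 / (2 * (v:ℝ))) * x ^ 2 = -x ^ 2 / (2 * v) := by ring
    rw [this]; ring
  have hev : ∀ x : ℝ, |-(x / v) * gaussianPDFReal 0 v x| = (fun y => -(-(y / v) * gaussianPDFReal 0 v y)) |x| := by
    intro x
    rw [abs_mul, abs_of_nonneg (gaussianPDFReal_nonneg _ _ _), abs_neg, abs_div, abs_of_pos hv']
    simp [gaussianPDFReal_def]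
  rw [← ofReal_integral_eq_lintegral_ofReal hint.abs (ae_of_all _ fun _ => abs_nonneg _)]
  congr 1
  simp_rw [hev]
  rw [integral_comp_abs (f := fun y => -(-(y / v) * gaussianPDFReal 0 v y)), integral_neg]
  have ht : Tendsto (gaussianPDFReal 0 v) atTop (𝓝 0) := by
    rw [gaussianPDFReal_def]
    suffices h : Tendsto (fun x : ℝ => -(x - 0) ^ 2 / (2 * (v:ℝ))) atTop atBot by
      simpa using (Real.tendsto_exp_atBot.comp h).const_mul (√(2 * π * v))⁻¹
    simp only [sub_zero, neg_div]
    refine tendsto_neg_atTop_atBot.comp ?_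
    exact (tendsto_pow_atTop two_ne_zero).atTop_div_const (by positivity)
  rw [integral_Ioi_of_hasDerivAt_of_nonpos' (fun x _ => gsd_psi_deriv v hv x) ?_ ht]
  · simp only [gaussianPDFReal_def]
    simp only [sub_self, zero_sub, neg_neg]
    have e : 2 / (π * (v:ℝ)) = 2 ^ 2 * (2 * π * v)⁻¹ := by field_simp
    rw [e, Real.sqrt_mul (x := (2:ℝ) ^ 2) (by positivity), Real.sqrt_sq (by norm_num), Real.sqrt_inv]
    simp
  · intro x hx
    have : (0:ℝ) < x := hx
    have h2 := gaussianPDFReal_nonneg 0 v x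
    have : 0 ≤ x / v := by positivity
    nlinarith

lemma gsd_tv {f g : ℝ → ℝ} (hf : Measurable f) (hg : Measurable g) :
    tvDist (volume.withDensity fun y => ENNReal.ofReal (f y))
      (volume.withDensity fun y => ENNReal.ofReal (g y)) ≤ ∫⁻ y, ENNReal.ofReal |f y - g y| := by
  have key : ∀ f g : ℝ → ℝ, Measurable f → Measurable g →
      (⨆ B : {B : Set ℝ // MeasurableSet B}, ((volume.withDensity fun y => ENNReal.ofReal (f y)) B
        - (volume.withDensity fun y => ENNReal.ofReal (g y)) B))
      ≤ ∫⁻ y, ENNReal.ofReal (f y - g y) := by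
    intro f g hf hg
    refine iSup_le fun ⟨B, hB⟩ => ?_
    rw [tsub_le_iff_right]
    simp only [withDensity_apply _ hB]
    calc _ ≤ ∫⁻ y in B, (ENNReal.ofReal (f y - g y) + ENNReal.ofReal (g y)) := by
          refine lintegral_mono fun y => ?_
          refine le_trans (ENNReal.ofReal_le_ofReal ?_) ENNReal.ofReal_add_le
          linarith
      _ = (∫⁻ y in B, ENNReal.ofReal (f y - g y)) + ∫⁻ y in B, ENNReal.ofReal (g y) :=
          lintegral_add_right _ (by fun_prop)
      _ ≤ _ := add_le_add (setLIntegral_le_lintegral _ _) le_rfl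
  refine le_trans (add_le_add (key f g hf hg) (key g f hg hf)) ?_
  rw [← lintegral_add_left (by fun_prop)]
  refine lintegral_mono fun y => ?_
  rcases le_total (f y) (g y) with h | h
  · rw [ENNReal.ofReal_of_nonpos (p := f y - g y) (by linarith), zero_add]
    exact ENNReal.ofReal_le_ofReal (by rw [abs_sub_comm]; exact le_abs_self _)
  · rw [ENNReal.ofReal_of_nonpos (p := g y - f y) (by linarith), add_zero]
    exact ENNReal.ofReal_le_ofReal (le_abs_self _)

/-- L1 modulus of continuity -/
lemma gsd_shift {p q : ℝ → ℝ} (hq : Continuous q) (hpq : ∀ y, HasDerivAt p (q y) y) (z : ℝ) :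
    ∫⁻ y, ENNReal.ofReal |p (y - z) - p y|
      ≤ ENNReal.ofReal |z| * ∫⁻ y, ENNReal.ofReal |q y| := by
  have h1 : ∀ y, ENNReal.ofReal |p (y - z) - p y| ≤
      ∫⁻ t in Ioc (0:ℝ) 1, ENNReal.ofReal |z| * ENNReal.ofReal |q (y - t * z)| := by
    intro y
    have hd : ∀ t ∈ uIcc (0:ℝ) 1, HasDerivAt (fun t : ℝ => p (y - t * z)) (q (y - t * z) * (-z)) t := by
      intro t _
      have h2 : HasDerivAt (fun t : ℝ => y - t * z) (-z) t := by
        simpa using ((hasDerivAt_id t).mul_const z).const_sub y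
      exact (hpq (y - t * z)).comp t h2
    have hc : Continuous fun t : ℝ => q (y - t * z) * (-z) := by fun_prop
    have h3 := intervalIntegral.integral_eq_sub_of_hasDerivAt hd (hc.intervalIntegrable _ _)
    simp only [one_mul, zero_mul, sub_zero] at h3
    rw [← h3, intervalIntegral.integral_of_le zero_le_one, ← Real.norm_eq_abs, ofReal_norm]
    refine (enorm_integral_le_lintegral_enorm _).trans (le_of_eq ?_)
    refine lintegral_congr fun t => ?_
    rw [enorm_mul, enorm_neg, mul_comm, Real.enorm_eq_ofReal_abs, Real.enorm_eq_ofReal_abs]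
  refine (lintegral_mono h1).trans ?_
  rw [lintegral_lintegral_swap]
  · have : ∀ t : ℝ, ∫⁻ y, ENNReal.ofReal |z| * ENNReal.ofReal |q (y - t * z)|
        = ENNReal.ofReal |z| * ∫⁻ y, ENNReal.ofReal |q y| := by
      intro t
      rw [lintegral_const_mul _ (by fun_prop)]
      rw [lintegral_sub_right_eq_self (fun y => ENNReal.ofReal |q y|)]
    simp [this]
  · have : Measurable q := hq.measurable
    apply Measurable.aemeasurable
    fun_prop

lemma gsd_law {Ω : Type*} {mΩ : MeasurableSpace Ω} (P : Measure Ω) [IsProbabilityMeasure P]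
    (v : ℝ≥0) (hv : 0 < v) (H J : Ω → ℝ) (hH : Measurable H) (hJ : Measurable J)
    (hlaw : Measure.map H P = gaussianReal 0 v) (hindep : IndepFun H J P) (p : ℝ → ℝ)
    (hp : ∀ y, p y = ∫ ω, gaussianPDFReal 0 v (y - J ω) ∂P) :
    Measure.map (fun ω => H ω + J ω) P = volume.withDensity (fun y => ENNReal.ofReal (p y)) := by
  have hφ := measurable_gaussianPDFReal 0 v
  have hofp : ∀ y, ENNReal.ofReal (p y) = ∫⁻ ω, ENNReal.ofReal (gaussianPDFReal 0 v (y - J ω)) ∂P := by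
    intro y
    rw [hp, ofReal_integral_eq_lintegral_ofReal]
    · exact Integrable.of_bound
        (hφ.comp (measurable_const.sub hJ)).aestronglyMeasurable _ (ae_of_all _ fun ω => gsd_phi_bound v _)
    · exact ae_of_all _ fun ω => gaussianPDFReal_nonneg _ _ _
  have hpm : Measurable fun y => ENNReal.ofReal (p y) := by
    simp_rw [hofp]
    apply Measurable.lintegral_prod_right'
      (f := fun z : ℝ × Ω => ENNReal.ofReal (gaussianPDFReal 0 v (z.1 - J z.2)))
    fun_prop
  refine Measure.ext_of_lintegral _ fun f hf => ?_
  have h1 : Measure.map (fun ω => H ω + J ω) P = Measure.map J P ∗ Measure.map H P := by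
    have := hindep.symm.map_add_eq_map_conv_map₀ hJ.aemeasurable hH.aemeasurable
    rw [← this]; congr 1; ext ω; simp [add_comm]
  rw [h1, hlaw, Measure.lintegral_conv hf, lintegral_map (by fun_prop) hJ,
    lintegral_withDensity_eq_lintegral_mul _ hpm hf]
  simp only [Pi.mul_apply, hofp]
  have h2 : ∀ ω, ∫⁻ x, f (J ω + x) ∂(gaussianReal 0 v)
      = ∫⁻ y, ENNReal.ofReal (gaussianPDFReal 0 v (y - J ω)) * f y := by
    intro ω
    rw [gaussianReal_of_var_ne_zero _ hv.ne', lintegral_withDensity_eq_lintegral_mul _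
      (measurable_gaussianPDF _ _) (by fun_prop)]
    rw [← lintegral_add_left_eq_self
      (fun y => ENNReal.ofReal (gaussianPDFReal 0 v (y - J ω)) * f y) (J ω)]
    simp [gaussianPDF]
  simp_rw [h2]
  rw [lintegral_lintegral_swap (by fun_prop)]
  refine lintegral_congr fun y => ?_
  rw [lintegral_mul_const _ (by fun_prop)]

/-- Gaussian smoothing: if `G ~ N(0,s)` and `J` is independent of `G`, then `X = σG + J` has
the continuously differentiable density `p(y) = E φ_{σ²s}(y − J)` with
`‖p'‖_{L_1} ≤ √(2/(πσ²)) s^{−1/2}`; consequently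
`‖law(z+X) − law(X)‖_TV ≤ √(2/(πσ²)) |z| s^{−1/2}` for every `z ∈ ℝ`. -/
theorem gaussian_smoothing_density
    {Ω : Type*} {mΩ : MeasurableSpace Ω} (P : Measure Ω) [IsProbabilityMeasure P]
    (σ : ℝ) (hσ : 0 < σ) (s : ℝ≥0) (hs : 0 < s)
    (G J : Ω → ℝ) (hG : Measurable G) (hJ : Measurable J)
    (hGlaw : Measure.map G P = ProbabilityTheory.gaussianReal 0 s)
    (hindep : ProbabilityTheory.IndepFun G J P)
    (p : ℝ → ℝ)
    (hp : ∀ y : ℝ, p y =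
      ∫ ω, ProbabilityTheory.gaussianPDFReal 0 ((σ ^ 2).toNNReal * s) (y - J ω) ∂P) :
    ContDiff ℝ 1 p ∧
    Measure.map (fun ω => σ * G ω + J ω) P =
      MeasureTheory.volume.withDensity (fun y => ENNReal.ofReal (p y)) ∧
    (∫⁻ y, ENNReal.ofReal |deriv p y|)
      ≤ ENNReal.ofReal (Real.sqrt (2 / (Real.pi * σ ^ 2)) * (s : ℝ) ^ (-(1:ℝ) / 2)) ∧
    ∀ z : ℝ,
      tvDist (Measure.map (fun ω => z + (σ * G ω + J ω)) P)
          (Measure.map (fun ω => σ * G ω + J ω) P)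
        ≤ ENNReal.ofReal
            (Real.sqrt (2 / (Real.pi * σ ^ 2)) * |z| * (s : ℝ) ^ (-(1:ℝ) / 2)) := by
  have hv0 : 0 < (σ ^ 2).toNNReal * s := mul_pos (by simpa using by positivity) hs
  have hvc : (((σ ^ 2).toNNReal * s : ℝ≥0) : ℝ) = σ ^ 2 * s := by
    rw [NNReal.coe_mul, Real.coe_toNNReal _ (by positivity)]
  have hs' : (0:ℝ) < s := hs
  have hHlaw : Measure.map (fun ω => σ * G ω) P = gaussianReal 0 ((σ ^ 2).toNNReal * s) := by
    have h1 : Measure.map (fun ω => σ * G ω) P = (Measure.map G P).map (σ * ·) := by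
      rw [Measure.map_map (by fun_prop) hG]; rfl
    rw [h1, hGlaw, gaussianReal_map_const_mul, mul_zero]
    congr 2
    ext
    simp [Real.coe_toNNReal _ (sq_nonneg σ)]
  have hHindep : IndepFun (fun ω => σ * G ω) J P :=
    hindep.comp (φ := fun x => σ * x) (ψ := id) (by fun_prop) measurable_id
  have hlaw := gsd_law P _ hv0 (fun ω => σ * G ω) J (by fun_prop) hJ hHlaw hHindep p hp
  have hconst : √(2 / (Real.pi * (((σ ^ 2).toNNReal * s : ℝ≥0) : ℝ)))
      = √(2 / (Real.pi * σ ^ 2)) * (s : ℝ) ^ (-(1:ℝ) / 2) := by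
    rw [hvc, neg_div, Real.rpow_neg hs'.le, ← Real.sqrt_eq_rpow, ← Real.sqrt_inv,
      ← Real.sqrt_mul (by positivity)]
    congr 1
    field_simp
  generalize (σ ^ 2).toNNReal * s = v at *
  have hφm := gsd_phi_cont v
  have hψm := gsd_psi_cont v
  obtain ⟨C, hC⟩ := gsd_psi_bound v hv0
  obtain ⟨q, hqdef⟩ : ∃ q : ℝ → ℝ, ∀ y, q y =
    ∫ ω, (fun x : ℝ => -(x / v) * gaussianPDFReal 0 v x) (y - J ω) ∂P := ⟨_, fun _ => rfl⟩
  have hψJ : ∀ y : ℝ, Measurable fun ω => (fun x : ℝ => -(x / v) * gaussianPDFReal 0 v x) (y - J ω) :=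
    fun y => hψm.measurable.comp (by fun_prop)
  have hφJ : ∀ y : ℝ, Measurable fun ω => gaussianPDFReal 0 v (y - J ω) :=
    fun y => hφm.measurable.comp (by fun_prop)
  have hqc : Continuous q := by
    rw [funext hqdef]
    refine continuous_of_dominated (bound := fun _ => C) (fun y => (hψJ y).aestronglyMeasurable)
      (fun y => ae_of_all _ fun ω => hC _) (integrable_const _) (ae_of_all _ fun ω => ?_)
    exact hψm.comp (by fun_prop)
  have hpq : ∀ y, HasDerivAt p (q y) y := by
    intro y
    rw [funext hp, hqdef]
    refine (hasDerivAt_integral_of_dominated_loc_of_deriv_le (s := univ) (bound := fun _ => C)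
      (F' := fun y ω => (fun x : ℝ => -(x / v) * gaussianPDFReal 0 v x) (y - J ω))
      Filter.univ_mem (Filter.Eventually.of_forall fun y => (hφJ y).aestronglyMeasurable) ?_
      (hψJ y).aestronglyMeasurable
      (ae_of_all _ fun ω x _ => hC _) (integrable_const _) (ae_of_all _ fun ω x _ => ?_)).2
    · exact Integrable.of_bound (hφJ y).aestronglyMeasurable _
        (ae_of_all _ fun ω => gsd_phi_bound v _)
    · exact (gsd_psi_deriv v hv0 (x - J ω)).comp_sub_const x (J ω)
  have hderiv : deriv p = q := funext fun y => (hpq y).deriv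
  have hpd : Differentiable ℝ p := fun y => (hpq y).differentiableAt
  have hL1 : (∫⁻ y, ENNReal.ofReal |q y|)
      ≤ ENNReal.ofReal (√(2 / (Real.pi * σ ^ 2)) * (s : ℝ) ^ (-(1:ℝ) / 2)) := by
    rw [← hconst, ← gsd_psi_int v hv0]
    calc ∫⁻ y, ENNReal.ofReal |q y|
        ≤ ∫⁻ y, ∫⁻ ω, ENNReal.ofReal |(fun x : ℝ => -(x / v) * gaussianPDFReal 0 v x) (y - J ω)| ∂P := by
          refine lintegral_mono fun y => ?_
          rw [hqdef, ← Real.enorm_eq_ofReal_abs]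
          refine (enorm_integral_le_lintegral_enorm _).trans (le_of_eq ?_)
          exact lintegral_congr fun ω => Real.enorm_eq_ofReal_abs _
      _ = ∫⁻ ω, (∫⁻ y, ENNReal.ofReal |(fun x : ℝ => -(x / v) * gaussianPDFReal 0 v x) (y - J ω)|) ∂P := by
          refine lintegral_lintegral_swap (Measurable.aemeasurable ?_)
          have : Measurable fun z : ℝ × Ω =>
              (fun x : ℝ => -(x / v) * gaussianPDFReal 0 v x) (z.1 - J z.2) :=
            hψm.measurable.comp (by fun_prop)
          exact (continuous_abs.measurable.comp this).ennreal_ofReal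
      _ = ∫⁻ ω, (∫⁻ x : ℝ, ENNReal.ofReal |-(x / v) * gaussianPDFReal 0 v x|) ∂P := by
          refine lintegral_congr fun ω => ?_
          exact lintegral_sub_right_eq_self
            (fun x : ℝ => ENNReal.ofReal |-(x / v) * gaussianPDFReal 0 v x|) (J ω)
      _ = _ := by simp
      _ ≤ _ := le_rfl
  refine ⟨contDiff_one_iff_deriv.2 ⟨hpd, hderiv ▸ hqc⟩, hlaw, hderiv ▸ hL1, fun z => ?_⟩
  have hlawz := gsd_law P _ hv0 (fun ω => σ * G ω) (fun ω => z + J ω) (by fun_prop) (by fun_prop)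
    hHlaw (hHindep.comp (φ := id) (ψ := fun x => z + x) measurable_id (by fun_prop))
    (fun y => p (y - z)) (fun y => by
      simp only [hp]; congr 1; ext ω; congr 1; ring)
  have hz : (fun ω => z + (σ * G ω + J ω)) = fun ω => σ * G ω + (z + J ω) := by
    ext ω; ring
  rw [hz, hlawz, hlaw]
  have hpm : Measurable p := hpd.continuous.measurable
  refine (gsd_tv (by fun_prop) hpm).trans ((gsd_shift hqc hpq z).trans ?_)
  calc _ ≤ ENNReal.ofReal |z| *
        ENNReal.ofReal (√(2 / (Real.pi * σ ^ 2)) * (s : ℝ) ^ (-(1:ℝ) / 2)) := by gcongr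
    _ = _ := by
      rw [← ENNReal.ofReal_mul (abs_nonneg _)]
      congr 1; ring
end
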